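/- arXiv:2512.08494 — 5 statements merged into one kernel-verified Lean document; each statement's English description precedes it below -/
import Mathlib

section
/- If E is a nilpotent object of depth ≤ m and F is a nilpotent object of depth ≤ n in a k-linear abelian tensor category C, then E ⊗ F is a nilpotent object of depth ≤ m + n. -/
open CategoryTheory CategoryTheory.Limits MonoidalCategory

attribute [local instance] CategoryTheory.Limits.HasFiniteBiproducts.of_hasFiniteProducts

universe v u

variable (k : Type u) [Field k]

variable {C : Type u} [Category.{v} C] [Abelian C] [Linear k C]
  [MonoidalCategory C] [MonoidalPreadditive C]

/-- A *free* object of `C` is an object isomorphic to `V ⊗ 1_C` for a finite-dimensional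
`k`-vector space `V`, i.e. to a finite biproduct of copies of the unit object. -/
def IsFreeObj (E : C) : Prop :=
  ∃ n : ℕ, Nonempty (E ≅ ⨁ (fun (_ : Fin n) => (𝟙_ C)))

/-- `NilpotentDepth n E` means `E` admits a filtration
`0 = E₀ ⊆ E₁ ⊆ ... ⊆ Eₙ = E` whose successive quotients are free objects,
i.e. `E` is nilpotent of depth ≤ n. -/
inductive NilpotentDepth : ℕ → C → Prop
  | zero (E : C) (h : IsZero E) : NilpotentDepth 0 E
  | succ (n : ℕ) (E F : C) (f : F ⟶ E) (hf : Mono f)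
      (hF : NilpotentDepth n F) (hq : IsFreeObj (cokernel f)) :
      NilpotentDepth (n + 1) E

set_option linter.unusedSectionVars false

section ShortExact

variable {𝒜 : Type*} [Category* 𝒜] [Abelian 𝒜]

/-- `0 ⟶ A ⟶ X ⟶ B ⟶ 0` is a short exact sequence. -/
def IsShortExactPair {A X B : 𝒜} (f : A ⟶ X) (g : X ⟶ B) : Prop :=
  ∃ w : f ≫ g = 0, (ShortComplex.mk f g w).ShortExact

namespace IsShortExactPair

variable {A X B : 𝒜} {f : A ⟶ X} {g : X ⟶ B}

lemma zero (h : IsShortExactPair f g) : f ≫ g = 0 := h.1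

lemma mono (h : IsShortExactPair f g) : Mono f := h.2.mono_f

lemma epi (h : IsShortExactPair f g) : Epi g := h.2.epi_g

lemma exists_lift (h : IsShortExactPair f g) {T : 𝒜} (t : T ⟶ X) (ht : t ≫ g = 0) :
    ∃ l : T ⟶ A, l ≫ f = t :=
  ⟨_, (KernelFork.IsLimit.lift' h.2.fIsKernel t ht).2⟩

lemma exists_desc (h : IsShortExactPair f g) {T : 𝒜} (t : X ⟶ T) (ht : f ≫ t = 0) :
    ∃ d : B ⟶ T, g ≫ d = t :=
  ⟨_, (CokernelCofork.IsColimit.desc' h.2.gIsCokernel t ht).2⟩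

lemma of_lift (w : f ≫ g = 0) (hf : Mono f) (hg : Epi g)
    (h : ∀ {T : 𝒜} (t : T ⟶ X), t ≫ g = 0 → ∃ l : T ⟶ A, l ≫ f = t) :
    IsShortExactPair f g := by
  choose l hl using @h
  exact ⟨w, .mk' (ShortComplex.exact_of_f_is_kernel _ (KernelFork.IsLimit.ofι' f w
    fun t ht => ⟨l t ht, hl t ht⟩)) hf hg⟩

lemma of_desc (w : f ≫ g = 0) (hf : Mono f) (hg : Epi g)
    (h : ∀ {T : 𝒜} (t : X ⟶ T), f ≫ t = 0 → ∃ d : B ⟶ T, g ≫ d = t) :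
    IsShortExactPair f g := by
  choose d hd using @h
  exact ⟨w, .mk' (ShortComplex.exact_of_g_is_cokernel _ (CokernelCofork.IsColimit.ofπ' g w
    fun t ht => ⟨d t ht, hd t ht⟩)) hf hg⟩

lemma cokernel (f : A ⟶ X) [Mono f] : IsShortExactPair f (cokernel.π f) :=
  of_desc (cokernel.condition f) inferInstance inferInstance
    fun t ht => ⟨cokernel.desc f t ht, cokernel.π_desc f t ht⟩

lemma comp_iso (h : IsShortExactPair f g) {B' : 𝒜} (e : B ≅ B') :
    IsShortExactPair f (g ≫ e.hom) := by
  have := h.epi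
  refine of_desc (by rw [reassoc_of% h.zero, zero_comp]) h.mono inferInstance fun t ht => ?_
  obtain ⟨d, hd⟩ := h.exists_desc t ht
  exact ⟨e.inv ≫ d, by simpa using hd⟩

lemma comp_iso_comp (h : IsShortExactPair f g) {X' : 𝒜} (e : X ≅ X') :
    IsShortExactPair (f ≫ e.hom) (e.inv ≫ g) := by
  have := h.mono
  have := h.epi
  refine of_lift (by simp [h.zero]) inferInstance inferInstance fun t ht => ?_
  obtain ⟨l, hl⟩ := h.exists_lift (t ≫ e.inv) (by simpa using ht)
  exact ⟨l, by simp [reassoc_of% hl]⟩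

section Map

variable {A' X' B' : 𝒜} {f' : A' ⟶ X'} {g' : X' ⟶ B'} {a : A ⟶ A'} {x : X ⟶ X'} {b : B ⟶ B'}

lemma mono_middle (h : IsShortExactPair f g) (h' : IsShortExactPair f' g')
    (hl : a ≫ f' = f ≫ x) (hr : x ≫ g' = g ≫ b) (ha : Mono a) (hb : Mono b) : Mono x :=
  ShortComplex.mono_of_mono_of_mono_of_mono
    (ShortComplex.homMk (S₁ := .mk f g h.1) (S₂ := .mk f' g' h'.1) a x b hl hr)
    h.2.exact h'.2.mono_f ha hb

lemma isIso_middle (h : IsShortExactPair f g) (h' : IsShortExactPair f' g')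
    (hl : a ≫ f' = f ≫ x) (hr : x ≫ g' = g ≫ b) (ha : IsIso a) (hb : IsIso b) : IsIso x :=
  ShortComplex.isIso₂_of_shortExact_of_isIso₁₃'
    (ShortComplex.homMk (S₁ := .mk f g h.1) (S₂ := .mk f' g' h'.1) a x b hl hr)
    h.2 h'.2 ha hb

end Map

/-- Pulling a short exact sequence back along a monomorphism with cokernel `q`. -/
lemma pullback {N G : 𝒜} {j : N ⟶ B} {q : B ⟶ G} (h : IsShortExactPair f g)
    (h' : IsShortExactPair j q) :
    ∃ (P : 𝒜) (a : A ⟶ P) (b : P ⟶ N) (c : P ⟶ X),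
      IsShortExactPair a b ∧ IsShortExactPair c (g ≫ q) := by
  have := h.mono
  have := h.epi
  have := h'.mono
  have := h'.epi
  refine ⟨Limits.pullback g j, pullback.lift f 0 (by simp [h.zero]), pullback.snd g j,
    pullback.fst g j, ?_, ?_⟩
  · have hm : Mono (pullback.lift f 0 (by simp [h.zero]) : A ⟶ Limits.pullback g j) :=
      mono_of_mono_fac (pullback.lift_fst f 0 (by simp [h.zero]))
    refine of_lift (pullback.lift_snd _ _ _) hm inferInstance fun t ht => ?_
    obtain ⟨l, hl⟩ := h.exists_lift (t ≫ pullback.fst g j) (by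
      rw [Category.assoc, pullback.condition, reassoc_of% ht, zero_comp])
    exact ⟨l, pullback.hom_ext (by simp [pullback.lift_fst, hl]) (by simp [pullback.lift_snd, ht])⟩
  · refine of_lift (by rw [pullback.condition_assoc, h'.zero, comp_zero]) inferInstance
      (epi_comp g q) fun t ht => ?_
    obtain ⟨l, hl⟩ := h'.exists_lift (t ≫ g) (by simpa using ht)
    exact ⟨pullback.lift t l hl.symm, pullback.lift_fst _ _ _⟩

/-- Pushing a short exact sequence out along a morphism from its first term. -/
lemma of_isPushout {A' P : 𝒜} (h : IsShortExactPair f g) {a : A ⟶ A'} {l : X ⟶ P} {r : A' ⟶ P}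
    (sq : IsPushout f a l r) (q : P ⟶ B) (hl : l ≫ q = g) (hr : r ≫ q = 0) :
    IsShortExactPair r q := by
  have := h.mono
  have := h.epi
  have : Epi q := epi_of_epi_fac hl
  refine of_desc hr (MorphismProperty.of_isPushout (P := .monomorphisms _) sq.flip h.mono)
    inferInstance fun t ht => ?_
  obtain ⟨d, hd⟩ := h.exists_desc (l ≫ t) (by rw [sq.w_assoc, ht, comp_zero])
  exact ⟨d, sq.hom_ext (by rw [reassoc_of% hl, hd]) (by rw [reassoc_of% hr, zero_comp, ht])⟩

end IsShortExactPair

end ShortExact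

/-- `IteratedUnitExtension n E` means that `E` is obtained from `0` by `n` successive
extensions by the unit object. -/
inductive IteratedUnitExtension : ℕ → C → Prop
  | zero (E : C) (h : IsZero E) : IteratedUnitExtension 0 E
  | succ (n : ℕ) {N E : C} {i : N ⟶ E} {p : E ⟶ 𝟙_ C} (h : IsShortExactPair i p)
      (hN : IteratedUnitExtension n N) : IteratedUnitExtension (n + 1) E

namespace IteratedUnitExtension

lemma of_iso {n : ℕ} {E E' : C} (h : IteratedUnitExtension n E) (e : E ≅ E') :
    IteratedUnitExtension n E' := by
  cases h with
  | zero _ h => exact .zero _ (h.of_iso e.symm)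
  | succ n h hN => exact .succ n (h.comp_iso_comp e) hN

lemma unit : IteratedUnitExtension 1 (𝟙_ C) :=
  .succ 0 (i := (0 : kernel (𝟙 (𝟙_ C)) ⟶ 𝟙_ C)) (p := 𝟙 _)
    (.of_lift (by simp) ⟨fun _ _ _ => (isZero_kernel_of_mono (𝟙 (𝟙_ C))).eq_of_tgt _ _⟩
      inferInstance fun t ht => ⟨0, by simpa using ht.symm⟩)
    (.zero _ (isZero_kernel_of_mono _))

lemma extension {a b : ℕ} {A X B : C} {f : A ⟶ X} {g : X ⟶ B} (h : IsShortExactPair f g)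
    (hA : IteratedUnitExtension a A) (hB : IteratedUnitExtension b B) :
    IteratedUnitExtension (a + b) X := by
  induction hB generalizing X with
  | zero B hB =>
    have : IsIso f := h.2.isIso_f_iff.2 hB
    exact hA.of_iso (asIso f)
  | succ n h' _ ih =>
    obtain ⟨P, _, _, _, h₁, h₂⟩ := h.pullback h'
    exact .succ _ h₂ (ih h₁)

end IteratedUnitExtension

section Duals

variable {E D : C}

/-- If one triangle identity holds, the other zigzag is idempotent. -/
lemma zigzag_idempotent (c : 𝟙_ C ⟶ E ⊗ D) (v : D ⊗ E ⟶ 𝟙_ C)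
    (h : c ▷ E ⊗≫ E ◁ v = ⊗𝟙.hom) :
    (D ◁ c ⊗≫ v ▷ D) ⊗≫ (D ◁ c ⊗≫ v ▷ D) = D ◁ c ⊗≫ v ▷ D := by
  calc
    _ = D ◁ c ⊗≫ ((v ▷ D ▷ 𝟙_ C) ≫ (𝟙_ C ⊗ D) ◁ c) ⊗≫ v ▷ D := by
      monoidal
    _ = 𝟙 _ ⊗≫ D ◁ (c ▷ 𝟙_ C ≫ (E ⊗ D) ◁ c) ⊗≫ (v ▷ (D ⊗ E) ≫ 𝟙_ C ◁ v) ▷ D ⊗≫ 𝟙 _ := by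
      rw [← whisker_exchange]; monoidal
    _ = D ◁ c ⊗≫ D ◁ (c ▷ E ⊗≫ E ◁ v) ▷ D ⊗≫ v ▷ D := by
      rw [← whisker_exchange, ← whisker_exchange]; monoidal
    _ = D ◁ c ⊗≫ v ▷ D := by
      rw [h]; monoidal

/-- The left zigzag as an endomorphism. -/
def leftZigzagEnd (c : 𝟙_ C ⟶ E ⊗ D) (v : D ⊗ E ⟶ 𝟙_ C) : E ⟶ E :=
  (λ_ E).inv ≫ c ▷ E ≫ (α_ E D E).hom ≫ E ◁ v ≫ (ρ_ E).hom

/-- The right zigzag as an endomorphism. -/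
def rightZigzagEnd (c : 𝟙_ C ⟶ E ⊗ D) (v : D ⊗ E ⟶ 𝟙_ C) : D ⟶ D :=
  (ρ_ D).inv ≫ D ◁ c ≫ (α_ D E D).inv ≫ v ▷ D ≫ (λ_ D).hom

lemma rightZigzagEnd_comp_self (c : 𝟙_ C ⟶ E ⊗ D) (v : D ⊗ E ⟶ 𝟙_ C)
    (h : leftZigzagEnd c v = 𝟙 E) :
    rightZigzagEnd c v ≫ rightZigzagEnd c v = rightZigzagEnd c v := by
  have h' : c ▷ E ⊗≫ E ◁ v = ⊗𝟙.hom := by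
    calc
      _ = (λ_ E).hom ≫ leftZigzagEnd c v ≫ (ρ_ E).inv := by
        rw [leftZigzagEnd]; monoidal
      _ = _ := by rw [h]; monoidal
  calc
    _ = 𝟙 _ ⊗≫ ((D ◁ c ⊗≫ v ▷ D) ⊗≫ (D ◁ c ⊗≫ v ▷ D)) ⊗≫ 𝟙 _ := by
      rw [rightZigzagEnd]; monoidal
    _ = _ := by
      rw [zigzag_idempotent c v h', rightZigzagEnd]; monoidal

/-- An exact pairing from a pairing both of whose zigzags are the identity. -/
lemma nonempty_exactPairing_of_zigzag (c : 𝟙_ C ⟶ E ⊗ D) (v : D ⊗ E ⟶ 𝟙_ C)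
    (h : leftZigzagEnd c v = 𝟙 E) (h' : rightZigzagEnd c v = 𝟙 D) :
    Nonempty (ExactPairing E D) := by
  refine ⟨⟨c, v, ?_, ?_⟩⟩
  · rw [rightZigzagEnd, Iso.inv_comp_eq] at h'
    rw [← cancel_mono (λ_ D).hom]
    simpa using h'
  · rw [leftZigzagEnd, Iso.inv_comp_eq] at h
    rw [← cancel_mono (ρ_ E).hom]
    simpa using h

lemma leftZigzagEnd_comp_whiskerRight (c : 𝟙_ C ⟶ E ⊗ D) (v : D ⊗ E ⟶ 𝟙_ C) (u : E ⟶ E) :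
    leftZigzagEnd (c ≫ u ▷ D) v = leftZigzagEnd c v ≫ u := by
  simp only [leftZigzagEnd, comp_whiskerRight, Category.assoc]
  rw [associator_naturality_left_assoc, ← whisker_exchange_assoc, rightUnitor_naturality]

variable {N M : C} {i : N ⟶ E} {p : E ⟶ 𝟙_ C} {j : 𝟙_ C ⟶ D} {q : D ⟶ M}
  [ExactPairing N M] {c : 𝟙_ C ⟶ E ⊗ D} {v : D ⊗ E ⟶ 𝟙_ C}

lemma comp_leftZigzagEnd (hv : D ◁ i ≫ v = q ▷ N ≫ ε_ N M)
    (hc : c ≫ E ◁ q = η_ N M ≫ i ▷ M) : i ≫ leftZigzagEnd c v = i := by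
  calc
    _ = 𝟙 _ ⊗≫ ((𝟙_ C) ◁ i ≫ c ▷ E) ⊗≫ E ◁ v ⊗≫ 𝟙 _ := by
      rw [leftZigzagEnd]; monoidal
    _ = 𝟙 _ ⊗≫ c ▷ N ⊗≫ E ◁ (D ◁ i ≫ v) ⊗≫ 𝟙 _ := by
      rw [whisker_exchange]; monoidal
    _ = 𝟙 _ ⊗≫ (c ≫ E ◁ q) ▷ N ⊗≫ E ◁ (ε_ N M) ⊗≫ 𝟙 _ := by
      rw [hv]; monoidal
    _ = 𝟙 _ ⊗≫ (η_ N M) ▷ N ⊗≫ (i ▷ (M ⊗ N) ≫ E ◁ (ε_ N M)) ⊗≫ 𝟙 _ := by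
      rw [hc]; monoidal
    _ = 𝟙 _ ⊗≫ ((η_ N M) ▷ N ⊗≫ N ◁ (ε_ N M)) ⊗≫ i := by
      rw [← whisker_exchange]; monoidal
    _ = i := by
      rw [ExactPairing.evaluation_coevaluation'']; monoidal

lemma leftZigzagEnd_comp (hv : j ▷ E ≫ v = (λ_ E).hom ≫ p)
    (hc : c ≫ p ▷ D = j ≫ (λ_ D).inv) : leftZigzagEnd c v ≫ p = p := by
  calc
    _ = 𝟙 _ ⊗≫ c ▷ E ⊗≫ (E ◁ v ≫ p ▷ 𝟙_ C) ⊗≫ 𝟙 _ := by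
      rw [leftZigzagEnd]; monoidal
    _ = 𝟙 _ ⊗≫ (c ≫ p ▷ D) ▷ E ⊗≫ v := by
      rw [whisker_exchange]; monoidal
    _ = 𝟙 _ ⊗≫ (j ▷ E ≫ v) := by
      rw [hc]; monoidal
    _ = p := by
      rw [hv]; monoidal

lemma comp_rightZigzagEnd (hv : j ▷ E ≫ v = (λ_ E).hom ≫ p)
    (hc : c ≫ p ▷ D = j ≫ (λ_ D).inv) : j ≫ rightZigzagEnd c v = j := by
  calc
    _ = 𝟙 _ ⊗≫ (j ▷ 𝟙_ C ≫ D ◁ c) ⊗≫ v ▷ D ⊗≫ 𝟙 _ := by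
      rw [rightZigzagEnd]; monoidal
    _ = 𝟙 _ ⊗≫ c ⊗≫ (j ▷ E ≫ v) ▷ D ⊗≫ 𝟙 _ := by
      rw [← whisker_exchange]; monoidal
    _ = 𝟙 _ ⊗≫ (c ≫ p ▷ D) ⊗≫ 𝟙 _ := by
      rw [hv]; monoidal
    _ = j := by
      rw [hc]; monoidal

lemma rightZigzagEnd_comp (hv : D ◁ i ≫ v = q ▷ N ≫ ε_ N M)
    (hc : c ≫ E ◁ q = η_ N M ≫ i ▷ M) : rightZigzagEnd c v ≫ q = q := by
  calc
    _ = 𝟙 _ ⊗≫ D ◁ c ⊗≫ (v ▷ D ≫ (𝟙_ C) ◁ q) ⊗≫ 𝟙 _ := by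
      rw [rightZigzagEnd]; monoidal
    _ = 𝟙 _ ⊗≫ D ◁ (c ≫ E ◁ q) ⊗≫ v ▷ M ⊗≫ 𝟙 _ := by
      rw [← whisker_exchange]; monoidal
    _ = 𝟙 _ ⊗≫ D ◁ (η_ N M) ⊗≫ (D ◁ i ≫ v) ▷ M ⊗≫ 𝟙 _ := by
      rw [hc]; monoidal
    _ = 𝟙 _ ⊗≫ (D ◁ (η_ N M) ≫ q ▷ (N ⊗ M)) ⊗≫ (ε_ N M) ▷ M ⊗≫ 𝟙 _ := by
      rw [hv]; monoidal
    _ = q ⊗≫ (M ◁ (η_ N M) ⊗≫ (ε_ N M) ▷ M) ⊗≫ 𝟙 _ := by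
      rw [whisker_exchange]; monoidal
    _ = q := by
      rw [ExactPairing.coevaluation_evaluation'']; monoidal

/-- An extension of the unit by a dualizable object is dualizable, given a candidate dual
together with pairings that are compatible with the extensions. -/
lemma nonempty_exactPairing_of_extension (hE : IsShortExactPair i p) (hD : IsShortExactPair j q)
    (hv₁ : j ▷ E ≫ v = (λ_ E).hom ≫ p) (hv₂ : D ◁ i ≫ v = q ▷ N ≫ ε_ N M)
    (hc₁ : c ≫ p ▷ D = j ≫ (λ_ D).inv) (hc₂ : c ≫ E ◁ q = η_ N M ≫ i ▷ M) :
    Nonempty (ExactPairing E D) := by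
  have hi := comp_leftZigzagEnd hv₂ hc₂
  have hp := leftZigzagEnd_comp hv₁ hc₁
  have hz : IsIso (leftZigzagEnd c v) :=
    hE.isIso_middle hE (a := 𝟙 _) (b := 𝟙 _) (by simp [hi]) (by simp [hp])
      inferInstance inferInstance
  have hi' : i ≫ inv (leftZigzagEnd c v) = i := by rw [IsIso.comp_inv_eq, hi]
  have hp' : inv (leftZigzagEnd c v) ≫ p = p := by rw [IsIso.inv_comp_eq, hp]
  have hl : leftZigzagEnd (c ≫ inv (leftZigzagEnd c v) ▷ D) v = 𝟙 E := by
    rw [leftZigzagEnd_comp_whiskerRight, IsIso.hom_inv_id]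
  have hc₁' : (c ≫ inv (leftZigzagEnd c v) ▷ D) ≫ p ▷ D = j ≫ (λ_ D).inv := by
    rw [Category.assoc, ← comp_whiskerRight, hp', hc₁]
  have hc₂' : (c ≫ inv (leftZigzagEnd c v) ▷ D) ≫ E ◁ q = η_ N M ≫ i ▷ M := by
    rw [Category.assoc, ← whisker_exchange, reassoc_of% hc₂, ← comp_whiskerRight, hi']
  have hr : IsIso (rightZigzagEnd (c ≫ inv (leftZigzagEnd c v) ▷ D) v) :=
    hD.isIso_middle hD (a := 𝟙 _) (b := 𝟙 _) (by simp [comp_rightZigzagEnd hv₁ hc₁'])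
      (by simp [rightZigzagEnd_comp hv₂ hc₂']) inferInstance inferInstance
  refine nonempty_exactPairing_of_zigzag _ v hl ?_
  rw [← cancel_mono (rightZigzagEnd (c ≫ inv (leftZigzagEnd c v) ▷ D) v),
    rightZigzagEnd_comp_self _ v hl, Category.id_comp]

end Duals

section Exactness

variable {X Y Z : C} {f : X ⟶ Y} {g : Y ⟶ Z}

lemma mono_whiskerLeft_of_exactPairing (M M' : C) [ExactPairing M M'] [Mono f] : Mono (M ◁ f) := by
  have := (tensorLeftAdjunction M M').rightAdjoint_preservesLimits
  exact inferInstanceAs (Mono ((tensorLeft M).map f))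

lemma epi_whiskerLeft_of_exactPairing (N M : C) [ExactPairing N M] [Epi f] : Epi (M ◁ f) := by
  have := (tensorLeftAdjunction N M).leftAdjoint_preservesColimits
  exact inferInstanceAs (Epi ((tensorLeft M).map f))

lemma epi_whiskerRight_of_exactPairing (N M : C) [ExactPairing N M] [Epi f] : Epi (f ▷ N) := by
  have := (tensorRightAdjunction N M).leftAdjoint_preservesColimits
  exact inferInstanceAs (Epi ((tensorRight N).map f))

lemma isZero_tensor_left {E : C} (h : IsZero E) (F : C) : IsZero (E ⊗ F) :=
  (tensorRight F).map_isZero h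

lemma isZero_tensor_right (E : C) {F : C} (h : IsZero F) : IsZero (E ⊗ F) :=
  (tensorLeft E).map_isZero h

namespace IsShortExactPair

lemma whiskerLeft_of_epi (h : IsShortExactPair f g) (M M' : C) [ExactPairing M M']
    (hg : Epi (M ◁ g)) : IsShortExactPair (M ◁ f) (M ◁ g) := by
  have := (tensorLeftAdjunction M M').rightAdjoint_preservesLimits
  have := h.mono
  refine ⟨by rw [← MonoidalCategory.whiskerLeft_comp, h.zero, MonoidalPreadditive.whiskerLeft_zero],
    .mk' ?_ (mono_whiskerLeft_of_exactPairing M M') hg⟩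
  exact h.2.exact.map_of_mono_of_preservesKernel (tensorLeft M) h.mono inferInstance

lemma exists_desc_whiskerRight (h : IsShortExactPair f g) (N M : C) [ExactPairing N M]
    {T : C} (t : Y ⊗ N ⟶ T) (ht : f ▷ N ≫ t = 0) : ∃ d : Z ⊗ N ⟶ T, g ▷ N ≫ d = t := by
  have := (tensorRightAdjunction N M).leftAdjoint_preservesColimits
  exact ⟨_, (CokernelCofork.IsColimit.desc'
    (CokernelCofork.mapIsColimit _ h.2.gIsCokernel (tensorRight N)) t ht).2⟩

lemma whiskerRight_of_mono (h : IsShortExactPair f g) (N M : C) [ExactPairing N M]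
    (hf : Mono (f ▷ N)) : IsShortExactPair (f ▷ N) (g ▷ N) := by
  have := h.epi
  exact of_desc (by rw [← comp_whiskerRight, h.zero, MonoidalPreadditive.zero_whiskerRight])
    hf (epi_whiskerRight_of_exactPairing N M) (h.exists_desc_whiskerRight N M)

end IsShortExactPair

end Exactness

section DualOfExtension

variable {N M M' E : C} {i : N ⟶ E} {p : E ⟶ 𝟙_ C}

lemma exists_exactPairing_of_extension [ExactPairing N M] [ExactPairing M M']
    (h : IsShortExactPair i p) :
    ∃ (D : C) (j : 𝟙_ C ⟶ D) (q : D ⟶ M), IsShortExactPair j q ∧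
      Nonempty (ExactPairing E D) := by
  have := h.mono
  have := h.epi
  have hM := h.whiskerLeft_of_epi M M' (epi_whiskerLeft_of_exactPairing N M)
  obtain ⟨D, s, j, q, hD, hs, hq⟩ : ∃ (D : C) (s : M ⊗ E ⟶ D) (j : 𝟙_ C ⟶ D) (q : D ⟶ M),
      IsShortExactPair j q ∧ M ◁ i ≫ s = - ε_ N M ≫ j ∧ s ≫ q = M ◁ p ≫ (ρ_ M).hom := by
    have sq := IsPushout.of_hasPushout (M ◁ i) (-ε_ N M)
    have hw : M ◁ i ≫ M ◁ p ≫ (ρ_ M).hom = (-ε_ N M) ≫ 0 := by simp [reassoc_of% hM.zero]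
    exact ⟨_, _, _, _, (hM.comp_iso (ρ_ M)).of_isPushout sq (sq.desc _ _ hw)
      (sq.inl_desc _ _ _) (sq.inr_desc _ _ _), by simpa using sq.w, sq.inl_desc _ _ _⟩
  have hj := hD.mono
  obtain ⟨v, hv⟩ := hD.exists_lift (D ◁ p ≫ (ρ_ D).hom - q ▷ E ≫ s) (by
    rw [Preadditive.sub_comp, Category.assoc, Category.assoc, hq, ← rightUnitor_naturality,
      whisker_exchange_assoc, sub_self])
  obtain ⟨c, hc⟩ := h.exists_desc ((ρ_ E).inv ≫ E ◁ j +
      (λ_ E).inv ≫ η_ N M ▷ E ≫ (α_ N M E).hom ≫ N ◁ s ≫ i ▷ D) (by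
    have e₁ : i ≫ (ρ_ E).inv ≫ E ◁ j = (ρ_ N).inv ≫ N ◁ j ≫ i ▷ D := by
      rw [rightUnitor_inv_naturality_assoc, whisker_exchange]
    have e₂ : i ≫ (λ_ E).inv ≫ η_ N M ▷ E ≫ (α_ N M E).hom ≫ N ◁ s ≫ i ▷ D =
        - (ρ_ N).inv ≫ N ◁ j ≫ i ▷ D := by
      calc
        _ = (λ_ N).inv ≫ η_ N M ▷ N ≫ (α_ N M N).hom ≫ N ◁ (M ◁ i ≫ s) ≫ i ▷ D := by
          rw [leftUnitor_inv_naturality_assoc, whisker_exchange_assoc,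
            MonoidalCategory.whiskerLeft_comp, Category.assoc, associator_naturality_right_assoc]
        _ = - (λ_ N).inv ≫ (η_ N M ▷ N ≫ (α_ N M N).hom ≫ N ◁ ε_ N M) ≫ N ◁ j ≫ i ▷ D := by
          have hn : N ◁ (-ε_ N M ≫ j) = -N ◁ (ε_ N M ≫ j) := (tensorLeft N).map_neg
          simp [hs, hn]
        _ = _ := by
          rw [ExactPairing.evaluation_coevaluation]
          simp
    rw [Preadditive.comp_add, e₁, e₂, add_neg_cancel])
  refine ⟨D, j, q, hD, nonempty_exactPairing_of_extension (v := v) (c := c) h hD ?_ ?_ ?_ ?_⟩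
  · rw [← cancel_mono j, Category.assoc, hv, Preadditive.comp_sub, ← whisker_exchange_assoc,
      ← comp_whiskerRight_assoc, hD.zero, MonoidalPreadditive.zero_whiskerRight, zero_comp,
      sub_zero, rightUnitor_naturality, ← unitors_equal, leftUnitor_naturality_assoc,
      Category.assoc]
  · rw [← cancel_mono j, Category.assoc, hv, Preadditive.comp_sub,
      ← MonoidalCategory.whiskerLeft_comp_assoc, h.zero, MonoidalPreadditive.whiskerLeft_zero,
      zero_comp, zero_sub, whisker_exchange_assoc, hs]
    simp
  · rw [← cancel_epi p, reassoc_of% hc, Preadditive.add_comp]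
    simp only [Category.assoc]
    rw [← comp_whiskerRight, h.zero, MonoidalPreadditive.zero_whiskerRight]
    simp only [comp_zero, add_zero]
    rw [whisker_exchange, ← rightUnitor_inv_naturality_assoc, leftUnitor_inv_naturality,
      unitors_inv_equal]
  · rw [← cancel_epi p, reassoc_of% hc, Preadditive.add_comp]
    simp only [Category.assoc]
    rw [← MonoidalCategory.whiskerLeft_comp, hD.zero, MonoidalPreadditive.whiskerLeft_zero,
      comp_zero, zero_add, ← whisker_exchange, ← MonoidalCategory.whiskerLeft_comp_assoc, hq,
      MonoidalCategory.whiskerLeft_comp, Category.assoc, ← associator_naturality_right_assoc,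
      ← whisker_exchange_assoc]
    have : p ≫ η_ N M = (λ_ E).inv ≫ 𝟙_ C ◁ p ≫ η_ N M ▷ 𝟙_ C ≫ (ρ_ _).hom := by
      simp [unitors_inv_equal]
    rw [reassoc_of% this]
    simp

end DualOfExtension

namespace IteratedUnitExtension

lemma exists_exactPairing {n : ℕ} : ∀ {N : C}, IteratedUnitExtension n N →
    ∃ M : C, IteratedUnitExtension n M ∧ Nonempty (ExactPairing N M) := by
  induction n with
  | zero =>
    rintro N (⟨_, h⟩ | _)
    exact ⟨N, .zero _ h, nonempty_exactPairing_of_zigzag 0 0 (h.eq_of_src _ _) (h.eq_of_src _ _)⟩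
  | succ n ih =>
    rintro E (_ | ⟨_, h, hN⟩)
    obtain ⟨M, hM, ⟨_⟩⟩ := ih hN
    obtain ⟨M', -, ⟨_⟩⟩ := ih hM
    obtain ⟨D, j, q, hD, hED⟩ := exists_exactPairing_of_extension (M := M) (M' := M') h
    exact ⟨D, add_comm 1 n ▸ unit.extension hD hM, hED⟩

end IteratedUnitExtension

namespace IteratedUnitExtension

lemma epi_whiskerLeft {a b c : ℕ} {E F G : C} (hE : IteratedUnitExtension a E)
    (hF : IteratedUnitExtension b F) (hG : IteratedUnitExtension c G) (q : F ⟶ G) [Epi q] :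
    Epi (E ◁ q) := by
  obtain ⟨F', -, ⟨_⟩⟩ := hF.exists_exactPairing
  obtain ⟨G', -, ⟨_⟩⟩ := hG.exists_exactPairing
  induction hE with
  | zero E h => exact ⟨fun _ _ _ => (isZero_tensor_left h G).eq_of_src _ _⟩
  | @succ n N E i p h hN ih =>
    have := h.epi
    have : Epi (p ▷ F) := epi_whiskerRight_of_exactPairing F F'
    refine Preadditive.epi_of_cancel_zero _ fun {T} t ht => ?_
    have hi : i ▷ G ≫ t = 0 := by
      rw [← cancel_epi (N ◁ q), whisker_exchange_assoc, ht, comp_zero, comp_zero]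
    obtain ⟨d, rfl⟩ := h.exists_desc_whiskerRight G G' t hi
    have : Epi (𝟙_ C ◁ q) := by rw [id_whiskerLeft]; infer_instance
    have hd : d = 0 := by
      rw [← cancel_epi (𝟙_ C ◁ q), ← cancel_epi (p ▷ F), ← whisker_exchange_assoc, ht, comp_zero,
        comp_zero]
    rw [hd, comp_zero]

lemma whiskerLeft {a b c : ℕ} {E X F G : C} (hE : IteratedUnitExtension a E)
    (hF : IteratedUnitExtension b F) (hG : IteratedUnitExtension c G) {j : X ⟶ F} {q : F ⟶ G}
    (h : IsShortExactPair j q) : IsShortExactPair (E ◁ j) (E ◁ q) := by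
  have := h.epi
  obtain ⟨E', -, ⟨_⟩⟩ := hE.exists_exactPairing
  exact h.whiskerLeft_of_epi E E' (hE.epi_whiskerLeft hF hG q)

lemma mono_whiskerRight {a b c : ℕ} {N E G : C} (hN : IteratedUnitExtension a N)
    (hE : IteratedUnitExtension b E) (hG : IteratedUnitExtension c G) (i : N ⟶ E) [Mono i] :
    Mono (i ▷ G) := by
  induction hG with
  | zero G h => exact ⟨fun _ _ _ => (isZero_tensor_right N h).eq_of_tgt _ _⟩
  | succ n h hG' ih =>
    exact (hN.whiskerLeft (.succ n h hG') unit h).mono_middle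
      (hE.whiskerLeft (.succ n h hG') unit h) (whisker_exchange _ _).symm
      (whisker_exchange _ _).symm ih (by rw [whiskerRight_id]; infer_instance)

lemma whiskerRight {a b c : ℕ} {N E Q G : C} (hN : IteratedUnitExtension a N)
    (hE : IteratedUnitExtension b E) (hG : IteratedUnitExtension c G) {i : N ⟶ E} {p : E ⟶ Q}
    (h : IsShortExactPair i p) : IsShortExactPair (i ▷ G) (p ▷ G) := by
  have := h.mono
  obtain ⟨G', -, ⟨_⟩⟩ := hG.exists_exactPairing
  exact h.whiskerRight_of_mono G G' (hN.mono_whiskerRight hE hG i)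

end IteratedUnitExtension

section Free

lemma isFreeObj_of_total {J : Type} [Fintype J] [DecidableEq J] {E : C} (ι : J → (𝟙_ C ⟶ E))
    (π : J → (E ⟶ 𝟙_ C)) (h : ∀ i j, ι i ≫ π j = if i = j then 𝟙 _ else 0)
    (total : ∑ j, π j ≫ ι j = 𝟙 E) : IsFreeObj E := by
  let b : Bicone (fun _ : J => 𝟙_ C) :=
    { pt := E, ι := ι, π := π, ι_π := fun i j => by
        rw [h]
        split_ifs <;> rfl }
  have e : E ≅ ⨁ (fun _ : J => 𝟙_ C) := biproduct.uniqueUpToIso _ (isBilimitOfTotal b total)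
  exact ⟨_, ⟨e ≪≫
    biproduct.whiskerEquiv (f := fun _ : J => 𝟙_ C) (g := fun _ => 𝟙_ C) (Fintype.equivFin J)
      fun _ => Iso.refl _⟩⟩

namespace IsFreeObj

lemma exists_total {E : C} (h : IsFreeObj E) : ∃ (n : ℕ) (ι : Fin n → (𝟙_ C ⟶ E))
    (π : Fin n → (E ⟶ 𝟙_ C)), (∀ i j, ι i ≫ π j = if i = j then 𝟙 _ else 0) ∧
      ∑ j, π j ≫ ι j = 𝟙 E := by
  obtain ⟨n, ⟨e⟩⟩ := h
  refine ⟨n, fun i => biproduct.ι (fun _ => 𝟙_ C) i ≫ e.inv, fun i => e.hom ≫ biproduct.π _ i,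
    fun i j => ?_, ?_⟩
  · simp [biproduct.ι_π]
  · have := congrArg (fun t => e.hom ≫ t ≫ e.inv)
        (biproduct.total (f := fun _ : Fin n => 𝟙_ C))
    simpa only [Preadditive.sum_comp, Preadditive.comp_sum, Category.assoc, Category.id_comp,
      Iso.hom_inv_id] using this

lemma of_iso {E E' : C} (h : IsFreeObj E) (e : E ≅ E') : IsFreeObj E' :=
  h.imp fun _ ⟨e'⟩ => ⟨e.symm ≪≫ e'⟩

lemma of_isZero {E : C} (h : IsZero E) : IsFreeObj E :=
  isFreeObj_of_total (J := Empty) nofun nofun nofun (h.eq_of_src _ _)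

lemma biprod {E F : C} (hE : IsFreeObj E) (hF : IsFreeObj F) : IsFreeObj (E ⊞ F) := by
  obtain ⟨m, ι, π, h, t⟩ := hE.exists_total
  obtain ⟨n, ι', π', h', t'⟩ := hF.exists_total
  refine isFreeObj_of_total (Sum.elim (fun i => ι i ≫ biprod.inl) fun i => ι' i ≫ biprod.inr)
    (Sum.elim (fun i => biprod.fst ≫ π i) fun i => biprod.snd ≫ π' i) ?_ ?_
  · rintro (i | i) (j | j) <;> simp [h, h']
  · have e := congrArg (fun s => (biprod.fst : E ⊞ F ⟶ E) ≫ s ≫ (biprod.inl : E ⟶ E ⊞ F)) t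
    have e' := congrArg (fun s => (biprod.snd : E ⊞ F ⟶ F) ≫ s ≫ (biprod.inr : F ⟶ E ⊞ F)) t'
    simp only [Preadditive.sum_comp, Preadditive.comp_sum, Category.id_comp,
      Category.assoc] at e e'
    simp [e, e']

lemma tensor {E F : C} (hE : IsFreeObj E) (hF : IsFreeObj F) : IsFreeObj (E ⊗ F) := by
  obtain ⟨m, ι, π, h, t⟩ := hE.exists_total
  obtain ⟨n, ι', π', h', t'⟩ := hF.exists_total
  refine isFreeObj_of_total (J := Fin m × Fin n) (fun i => (λ_ _).inv ≫ (ι i.1 ⊗ₘ ι' i.2))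
    (fun i => (π i.1 ⊗ₘ π' i.2) ≫ (λ_ _).hom) ?_ ?_
  · rintro ⟨i, i'⟩ ⟨j, j'⟩
    rw [Category.assoc, tensorHom_comp_tensorHom_assoc, h, h']
    by_cases hi : i = j <;> by_cases hj : i' = j' <;> simp [hi, hj]
  · have e : 𝟙 (E ⊗ F) = (𝟙 E ⊗ₘ 𝟙 F) := by simp
    rw [e, ← t, ← t', Fintype.sum_prod_type]
    simp only [tensor_sum, sum_tensor, Category.assoc, ← tensorHom_comp_tensorHom,
      Iso.hom_inv_id_assoc]
    exact Finset.sum_comm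

lemma iteratedUnitExtension {E : C} (h : IsFreeObj E) : ∃ n, IteratedUnitExtension n E := by
  obtain ⟨n, ⟨e⟩⟩ := h
  refine ⟨n, .of_iso ?_ e.symm⟩
  clear e
  induction n with
  | zero => exact .zero _ ((IsZero.iff_id_eq_zero _).2 (biproduct.hom_ext _ _ nofun))
  | succ n ih =>
    have hm : Mono (biproduct.desc fun i : Fin n =>
        biproduct.ι (fun _ : Fin (n + 1) => 𝟙_ C) i.succ) :=
      mono_of_mono_fac (show _ ≫ biproduct.lift (fun i : Fin n =>
          biproduct.π (fun _ : Fin (n + 1) => 𝟙_ C) i.succ) = 𝟙 _ by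
        ext i j
        simp [biproduct.ι_π])
    refine .succ n (i := biproduct.desc fun i : Fin n => biproduct.ι _ i.succ)
      (p := biproduct.π _ 0) (.of_lift ?_ hm inferInstance fun t ht =>
        ⟨biproduct.lift fun i => t ≫ biproduct.π _ i.succ, ?_⟩) ih
    · ext i
      simp [biproduct.ι_π_ne _ (Fin.succ_ne_zero i)]
    · ext j
      cases j using Fin.cases with
      | zero => simp [biproduct.lift_desc, Preadditive.sum_comp, ht]
      | succ j => simp [biproduct.lift_desc, Preadditive.sum_comp, biproduct.ι_π, comp_ite]

end IsFreeObj

end Free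

lemma NilpotentDepth.iteratedUnitExtension {n : ℕ} {E : C} (h : NilpotentDepth n E) :
    ∃ a, IteratedUnitExtension a E := by
  induction h with
  | zero E h => exact ⟨0, .zero E h⟩
  | succ n E F f hf hF hq ih =>
    obtain ⟨a, ha⟩ := ih
    obtain ⟨b, hb⟩ := hq.iteratedUnitExtension
    exact ⟨a + b, ha.extension (.cokernel f) hb⟩

/-- `f` is a monomorphism with free cokernel. -/
def FreeStep {A X : C} (f : A ⟶ X) : Prop :=
  ∃ (G : C) (g : X ⟶ G), IsShortExactPair f g ∧ IsFreeObj G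

lemma NilpotentDepth.of_freeStep {n : ℕ} {A X : C} {f : A ⟶ X} (hf : FreeStep f)
    (hA : NilpotentDepth n A) : NilpotentDepth (n + 1) X := by
  obtain ⟨G, g, h, hG⟩ := hf
  exact .succ n X A f h.mono hA
    (hG.of_iso (h.2.gIsCokernel.coconePointUniqueUpToIso (colimit.isColimit (parallelPair f 0))))

lemma NilpotentDepth.of_iso {n : ℕ} {X Y : C} (h : NilpotentDepth n X) (e : X ≅ Y) :
    NilpotentDepth n Y := by
  cases h with
  | zero _ h => exact .zero _ (h.of_iso e.symm)
  | succ n _ A f hf hA hq =>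
    exact .of_freeStep ⟨_, _, (IsShortExactPair.cokernel f).comp_iso_comp e, hq⟩ hA

namespace FreeStep

lemma of_isIso {A X : C} (f : A ⟶ X) [IsIso f] : FreeStep f :=
  ⟨_, _, .cokernel f, .of_isZero (isZero_cokernel_of_epi f)⟩

/-- The comparison map from a pushout along the left square of a morphism of short exact sequences
whose right component has free cokernel. -/
lemma of_isPushout_left {G₀ G₁ G B₀ B₁ B P : C} {γ : G₀ ⟶ G₁} {π : G₁ ⟶ G} {β : B₀ ⟶ B₁}
    {ρ : B₁ ⟶ B} {i₀ : G₀ ⟶ B₀} {i₁ : G₁ ⟶ B₁} {φ : G ⟶ B} (hγ : IsShortExactPair γ π)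
    (hβ : IsShortExactPair β ρ) (w : i₁ ≫ ρ = π ≫ φ) (hφ : FreeStep φ) {a : G₁ ⟶ P} {b : B₀ ⟶ P}
    (sq : IsPushout γ i₀ a b) {c : P ⟶ B₁} (ha : a ≫ c = i₁) (hb : b ≫ c = β) : FreeStep c := by
  obtain ⟨Q, r, hr, hQ⟩ := hφ
  have := hβ.epi
  have := hr.epi
  have := hγ.epi
  have hw : γ ≫ π = i₀ ≫ 0 := by rw [hγ.zero, comp_zero]
  have hc : Mono c :=
    (hγ.of_isPushout sq (sq.desc π 0 hw) (sq.inl_desc _ _ _) (sq.inr_desc _ _ _)).mono_middle hβ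
      (a := 𝟙 _) (b := φ) (by rw [hb, Category.id_comp])
      (sq.hom_ext (by rw [reassoc_of% ha, w, sq.inl_desc_assoc])
        (by rw [reassoc_of% hb, hβ.zero, sq.inr_desc_assoc, zero_comp])) inferInstance hr.mono
  refine ⟨Q, ρ ≫ r, .of_desc (sq.hom_ext ?_ ?_) hc inferInstance fun t ht => ?_, hQ⟩
  · rw [reassoc_of% ha, reassoc_of% w, hr.zero, comp_zero, comp_zero]
  · rw [reassoc_of% hb, reassoc_of% hβ.zero, zero_comp, comp_zero]
  · obtain ⟨d, rfl⟩ := hβ.exists_desc t (by rw [← hb, Category.assoc, ht, comp_zero])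
    obtain ⟨e, rfl⟩ := hr.exists_desc d (by
      rw [← cancel_epi π, ← reassoc_of% w, ← ha, Category.assoc, ht, comp_zero, comp_zero])
    exact ⟨e, Category.assoc _ _ _⟩

/-- Maps with free cokernel are compatible with gluing along a staircase of pushouts. -/
lemma of_isPushout_comp {G₀ G₁ B₀ B₁ P X₁ X₂ S S' : C} {γ : G₀ ⟶ G₁} {β : B₀ ⟶ B₁}
    {i₀ : G₀ ⟶ B₀} {i₁ : G₁ ⟶ B₁} {u : G₁ ⟶ X₁} {x : X₁ ⟶ X₂} (hx : FreeStep x)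
    {a : G₁ ⟶ P} {b : B₀ ⟶ P} (sq : IsPushout γ i₀ a b) {c : P ⟶ B₁} (hc : FreeStep c)
    (ha : a ≫ c = i₁) (hb : b ≫ c = β)
    {a₁ : X₁ ⟶ S} {b₁ : B₀ ⟶ S} (sq₁ : IsPushout (γ ≫ u) i₀ a₁ b₁)
    {a₂ : X₂ ⟶ S'} {b₂ : B₁ ⟶ S'} (sq₂ : IsPushout (u ≫ x) i₁ a₂ b₂)
    {σ : S ⟶ S'} (hσ : a₁ ≫ σ = x ≫ a₂) (hσ' : b₁ ≫ σ = β ≫ b₂) : FreeStep σ := by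
  obtain ⟨Q, q, hq, hQ⟩ := hx
  obtain ⟨R, r, hr, hR⟩ := hc
  have := hq.epi
  have := hr.epi
  have hm : Mono σ := by
    have := hq.mono
    have := hr.mono
    obtain ⟨κ, hκ, sqP⟩ : ∃ κ : P ⟶ S, b ≫ κ = b₁ ∧ IsPushout u a a₁ κ :=
      ⟨_, sq.inr_desc _ _ _, .of_left' sq₁ sq⟩
    obtain ⟨T, l, r, sqT⟩ : ∃ (T : C) (l : X₁ ⟶ T) (r : B₁ ⟶ T), IsPushout u i₁ l r :=
      ⟨_, _, _, .of_hasPushout u i₁⟩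
    have sqT' := sqT
    rw [← ha] at sqT'
    have h₁ := MorphismProperty.of_isPushout (P := .monomorphisms C) (sqT'.of_top' sqP) hr.mono
    have h₂ := MorphismProperty.of_isPushout (P := .monomorphisms C)
      (IsPushout.of_left' sq₂ sqT).flip hq.mono
    rw [MorphismProperty.monomorphisms.iff] at h₁ h₂
    convert mono_comp (sqP.desc l (c ≫ r) _) (sqT.desc (x ≫ a₂) b₂ _)
    refine sq₁.hom_ext ?_ ?_
    · rw [hσ, sqP.inl_desc_assoc, sqT.inl_desc]
    · rw [hσ', ← hb, ← hκ, Category.assoc, Category.assoc, sqP.inr_desc_assoc, Category.assoc,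
        sqT.inr_desc]
  have hw : (u ≫ x) ≫ q ≫ biprod.inl = i₁ ≫ r ≫ (biprod.inr : R ⟶ Q ⊞ R) := by
    rw [← ha, Category.assoc, Category.assoc, reassoc_of% hq.zero, reassoc_of% hr.zero]
    simp
  have hl := sq₂.inl_desc _ _ hw
  have hr' := sq₂.inr_desc _ _ hw
  refine ⟨Q ⊞ R, sq₂.desc (q ≫ biprod.inl) (r ≫ biprod.inr) hw, .of_desc ?_ hm ?_ ?_, hQ.biprod hR⟩
  · refine sq₁.hom_ext ?_ ?_
    · rw [reassoc_of% hσ, hl, reassoc_of% hq.zero, zero_comp, comp_zero]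
    · rw [reassoc_of% hσ', hr', ← hb, Category.assoc, reassoc_of% hr.zero, zero_comp, comp_zero,
        comp_zero]
  · refine Preadditive.epi_of_cancel_zero _ fun t ht => biprod.hom_ext' _ _ ?_ ?_
    · rw [← cancel_epi q, ← Category.assoc, ← hl, Category.assoc, ht]
      simp
    · rw [← cancel_epi r, ← Category.assoc, ← hr', Category.assoc, ht]
      simp
  · intro T t ht
    obtain ⟨d, hd⟩ := hq.exists_desc (a₂ ≫ t) (by rw [← reassoc_of% hσ, ht, comp_zero])
    obtain ⟨e, he⟩ := hr.exists_desc (b₂ ≫ t) (sq.hom_ext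
      (by rw [reassoc_of% ha, ← sq₂.w_assoc, ← hd, Category.assoc, reassoc_of% hq.zero]; simp)
      (by rw [reassoc_of% hb, ← reassoc_of% hσ', ht]; simp))
    exact ⟨biprod.desc d e, sq₂.hom_ext (by rw [reassoc_of% hl]; simp [hd])
      (by rw [reassoc_of% hr']; simp [he])⟩

end FreeStep

/-- `Tower E m n F X g` means that `g : E ⊗ F ⟶ X` lies over a filtration of length `n` of `F`
and a filtration of `X` which starts at an object of depth at most `m`. -/
inductive Tower (E : C) (m : ℕ) : ∀ (_ : ℕ) (F X : C), (E ⊗ F ⟶ X) → Prop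
  | zero {F X : C} (g : E ⊗ F ⟶ X) (hF : IsZero F) (hX : NilpotentDepth m X) : Tower E m 0 F X g
  | succ (n : ℕ) {F F' X X' : C} {f : F ⟶ F'} {x : X ⟶ X'} {g : E ⊗ F ⟶ X} {g' : E ⊗ F' ⟶ X'}
      (hf : FreeStep f) (hx : FreeStep x) (w : g ≫ x = E ◁ f ≫ g') (h : Tower E m n F X g) :
      Tower E m (n + 1) F' X' g'

namespace Tower

lemma nilpotentDepth_left {E F X : C} {m n : ℕ} {g : E ⊗ F ⟶ X} (h : Tower E m n F X g) :
    NilpotentDepth n F := by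
  induction h with
  | zero _ hF _ => exact .zero _ hF
  | succ _ hf _ _ _ ih => exact .of_freeStep hf ih

lemma nilpotentDepth_right {E F X : C} {m n : ℕ} {g : E ⊗ F ⟶ X} (h : Tower E m n F X g) :
    NilpotentDepth (m + n) X := by
  induction h with
  | zero _ _ hX => exact hX
  | succ _ _ hx _ _ ih => exact .of_freeStep hx ih

/-- Pushing a tower over `E'` out along a monomorphism `E' ⟶ E` with free cokernel. -/
lemma of_isPushout {a b m j : ℕ} {E' E F X X' S : C} (hE' : IteratedUnitExtension a E')
    (hE : IteratedUnitExtension b E) {i : E' ⟶ E} (hi : FreeStep i) {g : E' ⊗ F ⟶ X}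
    (h : Tower E' m j F X g) {x : X ⟶ X'} (hx : FreeStep x) {l : X' ⟶ S} {r : E ⊗ F ⟶ S}
    (sq : IsPushout (g ≫ x) (i ▷ F) l r) : Tower E (m + 1) j F S r := by
  induction h generalizing X' S with
  | zero g hF hX =>
    have : IsIso (i ▷ _) := isIso_of_isInitial
      (isZero_tensor_right E' hF).isInitial (isZero_tensor_right E hF).isInitial _
    have := sq.isIso_inl_of_isIso
    exact .zero _ hF ((NilpotentDepth.of_freeStep hx hX).of_iso (asIso l))
  | @succ n F F' X Y f y g g' hf hy w h ih =>
    obtain ⟨c, hF⟩ := h.nilpotentDepth_left.iteratedUnitExtension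
    obtain ⟨G, π, hπ, hG⟩ := hf
    obtain ⟨d, hG'⟩ := hG.iteratedUnitExtension
    have hF' := hF.extension hπ hG'
    obtain ⟨Q, p, hp, hQ⟩ := hi
    have sqP := IsPushout.of_hasPushout (E' ◁ f) (i ▷ F)
    have hc := FreeStep.of_isPushout_left (hE'.whiskerLeft hF' hG' hπ) (hE.whiskerLeft hF' hG' hπ)
      (whisker_exchange i π).symm ⟨_, _, hE'.whiskerRight hE hG' hp, hQ.tensor hG⟩ sqP
      (sqP.inl_desc (i ▷ F') (E ◁ f) (whisker_exchange i f))
      (sqP.inr_desc (i ▷ F') (E ◁ f) (whisker_exchange i f))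
    obtain ⟨S₀, l₀, r₀, sq₀⟩ : ∃ (S₀ : C) (l₀ : Y ⟶ S₀) (r₀ : E ⊗ F ⟶ S₀),
        IsPushout (g ≫ y) (i ▷ F) l₀ r₀ := ⟨_, _, _, .of_hasPushout _ _⟩
    have sq₁ := sq₀
    rw [w] at sq₁
    have hw : (g ≫ y) ≫ x ≫ l = i ▷ F ≫ E ◁ f ≫ r := by
      rw [w, ← whisker_exchange_assoc, ← sq.w]
      simp only [Category.assoc]
    exact .succ n ⟨G, π, hπ, hG⟩
      (hx.of_isPushout_comp sqP hc (sqP.inl_desc _ _ _) (sqP.inr_desc _ _ _) sq₁ sq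
        (sq₀.inl_desc _ _ hw) (sq₀.inr_desc _ _ hw))
      (sq₀.inr_desc _ _ hw) (ih hy sq₀)

end Tower

lemma NilpotentDepth.exists_tower {m n : ℕ} {E F : C} (hE : NilpotentDepth m E)
    (hF : NilpotentDepth n F) : ∃ (X : C) (g : E ⊗ F ⟶ X), Tower E m n F X g ∧ IsIso g := by
  induction hE with
  | zero E h =>
    refine ⟨E ⊗ F, 𝟙 _, ?_, inferInstance⟩
    induction hF with
    | zero F hF => exact .zero _ hF (.zero _ (isZero_tensor_left h F))
    | succ n F' F f hf hF hq ih =>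
      have : IsIso (E ◁ f) := isIso_of_isInitial
        (isZero_tensor_left h F).isInitial (isZero_tensor_left h F').isInitial _
      exact .succ n ⟨_, _, .cokernel f, hq⟩ (.of_isIso (E ◁ f)) (by simp) ih
  | succ m E E' i hi hE' hq ih =>
    obtain ⟨X, g, h, _⟩ := ih
    obtain ⟨a, ha⟩ := hE'.iteratedUnitExtension
    obtain ⟨b, hb⟩ := (NilpotentDepth.succ m E E' i hi hE' hq).iteratedUnitExtension
    have sq := IsPushout.of_hasPushout (g ≫ 𝟙 X) (i ▷ F)
    exact ⟨_, _, h.of_isPushout ha hb ⟨_, _, .cokernel i, hq⟩ (.of_isIso (𝟙 X)) sq,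
      sq.isIso_inr_of_isIso⟩

/-- If `E` is nilpotent of depth ≤ m and `F` is nilpotent of depth ≤ n, then
`E ⊗ F` is nilpotent of depth ≤ m + n. -/
theorem nilpotentDepth_tensor (m n : ℕ) (E F : C)
    (hE : NilpotentDepth m E) (hF : NilpotentDepth n F) :
    NilpotentDepth (m + n) (E ⊗ F) := by
  obtain ⟨X, g, h, _⟩ := hE.exists_tower hF
  exact h.nilpotentDepth_right.of_iso (asIso g).symm
end

section
/- The universal extension 0 → Ext¹(E,1_C)^∨ ⊗ 1_C → U(E) → E → 0 satisfies the following universal property: for any extension 0 → V ⊗ 1_C → F → E → 0 of E by a free object, there exists a unique k-linear map g : Ext¹(E,1_C)^∨ → V and a morphism U(E) → F making the diagram of the two extensions commute (with the identity on E and g ⊗ id on the kernels). -/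
open CategoryTheory CategoryTheory.Limits CategoryTheory.Abelian MonoidalCategory

attribute [local instance] CategoryTheory.Limits.HasFiniteBiproducts.of_hasFiniteProducts

universe w v u

variable (k : Type u) [Field k]

variable {C : Type u} [Category.{v} C] [Abelian C] [Linear k C]
  [MonoidalCategory C] [MonoidalPreadditive C] [HasExt.{w} C]

/-- Converse of `ShortComplex.ShortExact.extClass_naturality`: morphisms between the outer terms
of two short exact sequences that are compatible with the extension classes extend to a morphism
of short exact sequences. -/
theorem exists_shortComplex_hom_of_extClass_comp_eq {D : Type*} [Category* D] [Abelian D]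
    [HasExt.{w} D] {S T : ShortComplex D} (hS : S.ShortExact) (hT : T.ShortExact)
    (f : S.X₁ ⟶ T.X₁) (h : S.X₃ ⟶ T.X₃)
    (eq : hS.extClass.comp (Ext.mk₀ f) (add_zero 1) =
      (Ext.mk₀ h).comp hT.extClass (zero_add 1)) :
    ∃ φ : S ⟶ T, φ.τ₁ = f ∧ φ.τ₃ = h := by
  have := hS.epi_g
  obtain ⟨x, hx⟩ := Ext.contravariant_sequence_exact₁ hS T.X₂ (Ext.mk₀ (f ≫ T.f)) (add_zero 1) (by
    rw [← Ext.mk₀_comp_mk₀, ← Ext.comp_assoc_of_second_deg_zero, eq,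
      Ext.comp_assoc_of_third_deg_zero, hT.extClass_comp, Ext.comp_zero])
  obtain ⟨ψ, rfl⟩ := Ext.addEquiv₀.symm.surjective x
  have hψ : S.f ≫ ψ = f ≫ T.f := by
    apply Ext.addEquiv₀.symm.injective
    simpa using hx
  have hψ' : S.f ≫ ψ ≫ T.g = 0 := by rw [reassoc_of% hψ, T.zero, comp_zero]
  let d : S.X₃ ⟶ T.X₃ := hS.exact.desc (ψ ≫ T.g) hψ'
  have hd : S.g ≫ d = ψ ≫ T.g := hS.exact.g_desc _ _
  have nat := hS.extClass_naturality hT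
    { τ₁ := f, τ₂ := ψ, τ₃ := d, comm₁₂ := hψ.symm, comm₂₃ := hd.symm }
  obtain ⟨y, hy⟩ := Ext.covariant_sequence_exact₃ _ hT (Ext.mk₀ (h - d)) (zero_add 1) (by
    have hadd : Ext.mk₀ h = Ext.mk₀ (h - d) + Ext.mk₀ d := by
      rw [← Ext.mk₀_add, sub_add_cancel]
    rwa [eq, hadd, Ext.add_comp, add_eq_right] at nat)
  obtain ⟨s, rfl⟩ := Ext.addEquiv₀.symm.surjective y
  have hs : s ≫ T.g = h - d := by
    apply Ext.addEquiv₀.symm.injective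
    simpa using hy
  let φ : S ⟶ T :=
    { τ₁ := f
      τ₂ := ψ + S.g ≫ s
      τ₃ := h
      comm₁₂ := by simp [hψ]
      comm₂₃ := by simp [hs, hd] }
  exact ⟨φ, rfl, rfl⟩

/-- Degree-`n` extension classes with values in a biproduct are determined by their components. -/
theorem ext_biproduct_hom_ext {D : Type*} [Category* D] [Abelian D] [HasExt.{w} D]
    {X : D} {J : Type*} [Fintype J] {Y : J → D} [HasBiproduct Y] {n : ℕ}
    {α β : Ext X (⨁ Y) n}
    (h : ∀ j, α.comp (Ext.mk₀ (biproduct.π Y j)) (add_zero n) =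
      β.comp (Ext.mk₀ (biproduct.π Y j)) (add_zero n)) : α = β :=
  (Ext.addEquivBiproduct X (biproduct.isBilimit Y) n).injective (funext h)

/-- The universal property of the universal extension
`0 → Ext¹(E,1_C)^∨ ⊗ 1_C → U(E) → E → 0`: for any extension
`0 → V ⊗ 1_C → F → E → 0` of `E` by a free object, there is a unique `k`-linear map
`g : Ext¹(E,1_C)^∨ → V` together with a morphism `U(E) → F` making the diagram of the
two extensions commute (identity on `E`, `g ⊗ id` on the kernels).

Encoding: the universal extension is a short exact sequence `S` with `E = S.X₃` and
`S.X₁ ≅ ⨁_{i : ι} 1_C` (`ι` indexing a basis `b` of `Ext¹(E,1_C)`); the hypothesis `hb`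
says its extension class corresponds to the identity of `End(Ext¹(E,1_C))` and `hbasis`
that `b` is a basis (the connecting map `δ` is bijective); `hEnd` says `End(1_C) = k`.
The competing extension has kernel the free object `⨁_{j : Fin m} 1_C = V ⊗ 1_C`,
middle term `F` and maps `iF`, `pF`.  Since `End(1_C) = k`, morphisms
`⨁_{i : ι} 1_C ⟶ ⨁_{j : Fin m} 1_C` are exactly the maps `g ⊗ id` for `k`-linear maps
`g : Ext¹(E,1_C)^∨ → V`; the conclusion produces such a morphism `γ`, a (possibly
non-unique) middle morphism `φ : S.X₂ ⟶ F` making both squares commute, and states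
that `γ` is unique among morphisms fitting into such a commutative diagram. -/
theorem universal_extension_universal_property
    (ι : Type) [Fintype ι] [DecidableEq ι]
    (hEnd : Function.Bijective (fun a : k => a • 𝟙 (𝟙_ C)))
    (S : ShortComplex C) (hS : S.ShortExact)
    (e : S.X₁ ≅ ⨁ (fun (_ : ι) => (𝟙_ C)))
    (b : ι → Ext S.X₃ (𝟙_ C : C) 1)
    (δ : (S.X₁ ⟶ (𝟙_ C : C)) → Ext S.X₃ (𝟙_ C : C) 1)
    (hδ : ∀ f, δ f = hS.extClass.comp (Ext.mk₀ f) (add_zero 1))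
    (hb : ∀ i : ι, δ (e.hom ≫ biproduct.π _ i) = b i)
    (hbasis : Function.Bijective δ)
    -- an arbitrary extension of `E = S.X₃` by a free object `V ⊗ 1_C = ⨁_{j : Fin m} 1_C`
    (m : ℕ) (F : C) (iF : (⨁ (fun (_ : Fin m) => (𝟙_ C))) ⟶ F) (pF : F ⟶ S.X₃)
    (wF : iF ≫ pF = 0) (hF : (ShortComplex.mk iF pF wF).ShortExact) :
    ∃ γ : S.X₁ ⟶ (⨁ (fun (_ : Fin m) => (𝟙_ C))),
      (∃ φ : S.X₂ ⟶ F, φ ≫ pF = S.g ∧ S.f ≫ φ = γ ≫ iF) ∧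
      (∀ (γ' : S.X₁ ⟶ (⨁ (fun (_ : Fin m) => (𝟙_ C)))) (φ' : S.X₂ ⟶ F),
        φ' ≫ pF = S.g → S.f ≫ φ' = γ' ≫ iF → γ' = γ) := by
  have key (f : S.X₁ ⟶ ⨁ (fun (_ : Fin m) => (𝟙_ C))) (j : Fin m) :
      (hS.extClass.comp (Ext.mk₀ f) (add_zero 1)).comp
        (Ext.mk₀ (biproduct.π _ j)) (add_zero 1) = δ (f ≫ biproduct.π _ j) := by
    rw [hδ, Ext.comp_assoc_of_third_deg_zero, Ext.mk₀_comp_mk₀]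
  choose f hf using fun j : Fin m =>
    hbasis.2 (hF.extClass.comp (Ext.mk₀ (biproduct.π _ j)) (add_zero 1))
  have hγ : hS.extClass.comp (Ext.mk₀ (biproduct.lift f)) (add_zero 1) = hF.extClass :=
    ext_biproduct_hom_ext fun j => by rw [key, biproduct.lift_π, hf]
  refine ⟨biproduct.lift f, ?_, fun γ' φ' hg hf' => ?_⟩
  · obtain ⟨φ, h₁, h₃⟩ := exists_shortComplex_hom_of_extClass_comp_eq hS hF (biproduct.lift f)
      (𝟙 S.X₃) (hγ.trans (Ext.mk₀_id_comp _).symm)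
    refine ⟨φ.τ₂, ?_, ?_⟩
    · simpa [h₃] using φ.comm₂₃
    · simpa [h₁] using φ.comm₁₂.symm
  · have nat := hS.extClass_naturality hF
      { τ₁ := γ', τ₂ := φ', τ₃ := 𝟙 S.X₃, comm₁₂ := hf'.symm, comm₂₃ := by simpa using hg }
    have hγ' : hS.extClass.comp (Ext.mk₀ γ') (add_zero 1) = hF.extClass :=
      nat.trans (Ext.mk₀_id_comp _)
    refine biproduct.hom_ext _ _ fun j => hbasis.1 ?_
    rw [← key, ← key, hγ, hγ']
end

section
/- Let H be a commutative Hopf algebra over k and F a finite-dimensional comodule over H that is nilpotent of depth ≤ n (it admits a filtration 0 = F_0 ⊆ ... ⊆ F_n = F with each F_{i+1}/F_i a trivial comodule). Then the coaction Δ_F : F → F ⊗ H factors through F ⊗ C_{n-1}H, where C_{n-1}H is the (n-1)-st step of the conilpotency filtration of H. -/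
open scoped TensorProduct

universe u

variable (k : Type u) [Field k]

section Conilpotency

variable (H : Type u) [AddCommGroup H] [Module k H] [Coalgebra k H]

/-- Convolution product on the dual of a coalgebra: `(f * g)(x) = (f ⊗ g)(Δ x)`. -/
noncomputable def dualConv (f g : Module.Dual k H) : Module.Dual k H :=
  (TensorProduct.lid k k).toLinearMap ∘ₗ (TensorProduct.map f g) ∘ₗ Coalgebra.comul

/-- The convolution product of a finite family of functionals. -/
noncomputable def dualConvProd {m : ℕ} (f : Fin m → Module.Dual k H) : Module.Dual k H :=
  (List.ofFn f).foldr (dualConv k H) Coalgebra.counit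

/-- The conilpotency filtration of a coaugmented coalgebra with coaugmentation the
group-like element `g`: `Cₙ H = Ann_H ((I^∨)^{n+1})` where `I^∨ = {f | f g = 0}`. -/
noncomputable def conilpotencyFiltration (g : H) (n : ℕ) : Submodule k H :=
  ⨅ (f : Fin (n + 1) → Module.Dual k H) (_ : ∀ i, f i g = 0),
    LinearMap.ker (dualConvProd k H f)

end Conilpotency

/-- A functional `f` on `H` acts on a comodule `M` by `x ↦ (id ⊗ f)(ρ x)`. -/
noncomputable def dualAction {H M : Type*} [AddCommGroup H] [Module k H]
    [AddCommGroup M] [Module k M] (ρ : M →ₗ[k] M ⊗[k] H) (f : Module.Dual k H) : M →ₗ[k] M :=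
  (TensorProduct.rid k M).toLinearMap ∘ₗ LinearMap.lTensor M f ∘ₗ ρ

lemma dualAction_dualConv {H M : Type u} [AddCommGroup H] [Module k H] [Coalgebra k H]
    [AddCommGroup M] [Module k M] (ρ : M →ₗ[k] M ⊗[k] H)
    (coassoc : (TensorProduct.assoc k M H H).toLinearMap ∘ₗ
        (LinearMap.rTensor H ρ) ∘ₗ ρ =
      (LinearMap.lTensor M (Coalgebra.comul (R := k) (A := H))) ∘ₗ ρ)
    (f g : Module.Dual k H) :
    dualAction k ρ (dualConv k H f g) = dualAction k ρ f ∘ₗ dualAction k ρ g := by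
  let q : M ⊗[k] (H ⊗[k] H) →ₗ[k] M := (TensorProduct.rid k M).toLinearMap ∘ₗ
    LinearMap.lTensor M ((TensorProduct.lid k k).toLinearMap ∘ₗ TensorProduct.map f g)
  have hleft : dualAction k ρ (dualConv k H f g) =
      q ∘ₗ LinearMap.lTensor M (Coalgebra.comul (R := k) (A := H)) ∘ₗ ρ := by
    simp only [dualAction, dualConv, q, LinearMap.lTensor_comp, LinearMap.comp_assoc]
  have hassoc : q ∘ₗ (TensorProduct.assoc k M H H).toLinearMap =
      (TensorProduct.rid k M).toLinearMap ∘ₗ LinearMap.lTensor M g ∘ₗ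
        LinearMap.rTensor H ((TensorProduct.rid k M).toLinearMap ∘ₗ LinearMap.lTensor M f) := by
    ext m a b
    simp [q, smul_smul, mul_comm]
  have hright : (LinearMap.rTensor H
        ((TensorProduct.rid k M).toLinearMap ∘ₗ LinearMap.lTensor M f)) ∘ₗ LinearMap.rTensor H ρ =
      LinearMap.rTensor H (dualAction k ρ f) := by
    rw [← LinearMap.rTensor_comp, dualAction, LinearMap.comp_assoc]
  have hnat : (TensorProduct.rid k M).toLinearMap ∘ₗ LinearMap.lTensor M g ∘ₗ
        LinearMap.rTensor H (dualAction k ρ f) =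
      dualAction k ρ f ∘ₗ (TensorProduct.rid k M).toLinearMap ∘ₗ LinearMap.lTensor M g := by
    ext m a
    simp
  calc dualAction k ρ (dualConv k H f g)
      = (q ∘ₗ (TensorProduct.assoc k M H H).toLinearMap) ∘ₗ LinearMap.rTensor H ρ ∘ₗ ρ := by
        rw [hleft, ← coassoc]; rfl
    _ = ((TensorProduct.rid k M).toLinearMap ∘ₗ LinearMap.lTensor M g ∘ₗ
          ((LinearMap.rTensor H
            ((TensorProduct.rid k M).toLinearMap ∘ₗ LinearMap.lTensor M f)) ∘ₗ
              LinearMap.rTensor H ρ)) ∘ₗ ρ := by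
        rw [hassoc]; rfl
    _ = dualAction k ρ f ∘ₗ dualAction k ρ g := by
        rw [hright, hnat]; rfl

/-- A functional killing `g` lowers filtration if `ρ x - x ⊗ g` lies in the lower step. -/
lemma dualAction_mem_of_sub_mem {H M : Type*} [AddCommGroup H] [Module k H]
    [AddCommGroup M] [Module k M] (ρ : M →ₗ[k] M ⊗[k] H) (g : H) (N : Submodule k M)
    (f : Module.Dual k H) (hf : f g = 0) (x : M)
    (hx : ρ x - x ⊗ₜ[k] g ∈ LinearMap.range (LinearMap.rTensor H N.subtype)) :
    dualAction k ρ f x ∈ N := by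
  obtain ⟨y, hy⟩ := hx
  have hnat : (TensorProduct.rid k M).toLinearMap ∘ₗ LinearMap.lTensor M f ∘ₗ
        LinearMap.rTensor H N.subtype =
      N.subtype ∘ₗ (TensorProduct.rid k N).toLinearMap ∘ₗ LinearMap.lTensor N f := by
    ext m a
    simp
  have hval : dualAction k ρ f x = N.subtype (TensorProduct.rid k N (LinearMap.lTensor N f y)) := by
    have hy' := congrArg (fun z => TensorProduct.rid k M (LinearMap.lTensor M f z)) hy
    have hnat_y := LinearMap.congr_fun hnat y
    simp only [LinearMap.comp_apply, LinearEquiv.coe_coe] at hnat_y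
    simp only [hnat_y, map_sub, LinearMap.lTensor_tmul, hf, TensorProduct.tmul_zero,
      sub_zero] at hy'
    exact hy'.symm
  rw [hval]
  exact Subtype.prop _

/-- If all slices of a tensor by functionals in a family vanish, then the tensor lies in
`M ⊗ ⋂ ker`. -/
lemma mem_range_lTensor_of_forall_slice_eq_zero {H M : Type*} [AddCommGroup H] [Module k H]
    [AddCommGroup M] [Module k M] (C : Submodule k H) (S : Set (Module.Dual k H))
    (hC : ∀ h : H, (∀ f ∈ S, f h = 0) → h ∈ C) (t : M ⊗[k] H)
    (ht : ∀ f ∈ S, TensorProduct.rid k M (LinearMap.lTensor M f t) = 0) :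
    t ∈ LinearMap.range (LinearMap.lTensor M C.subtype) := by
  classical
  let b := Module.Basis.ofVectorSpace k M
  obtain ⟨c, rfl⟩ := TensorProduct.eq_repr_basis_left b t
  refine Submodule.sum_mem _ fun i _ => ⟨b i ⊗ₜ ⟨c i, hC _ fun f hf => ?_⟩, by simp⟩
  have hsum := ht f hf
  simp only [Finsupp.sum, map_sum, LinearMap.lTensor_tmul, TensorProduct.rid_tmul] at hsum
  by_cases hi : i ∈ c.support
  · exact linearIndependent_iff'.mp b.linearIndependent c.support (fun j => f (c j)) hsum i hi
  · rw [Finsupp.notMem_support_iff.mp hi, map_zero]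

/-- **Lemma 2.13**: let `H` be a commutative Hopf algebra over `k` and `F` a
comodule over `H` (i.e. a representation of the corresponding affine group scheme)
which is nilpotent of depth ≤ n: it has a filtration `0 = F₀ ⊆ F₁ ⊆ ... ⊆ Fₙ = F`
such that the coaction satisfies `ρ(x) ∈ x ⊗ 1 + F_{i-1} ⊗ H` for `x ∈ F_i`.
Then the coaction `ρ : F → F ⊗ H` factors through `F ⊗ C_{n-1}H`, where `C_•H` is the
conilpotency filtration of `H` (with coaugmentation the unit of `H`). -/
theorem coaction_factors_through_conilpotency_filtration
    (H : Type u) [CommRing H] [HopfAlgebra k H]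
    (M : Type u) [AddCommGroup M] [Module k M]
    (ρ : M →ₗ[k] M ⊗[k] H)
    -- comodule axioms
    (coassoc : (TensorProduct.assoc k M H H).toLinearMap ∘ₗ
        (LinearMap.rTensor H ρ) ∘ₗ ρ = (LinearMap.lTensor M (Coalgebra.comul (R := k) (A := H))) ∘ₗ ρ)
    (counit_coaction : (TensorProduct.rid k M).toLinearMap ∘ₗ
        (LinearMap.lTensor M (Coalgebra.counit (R := k) (A := H))) ∘ₗ ρ = LinearMap.id)
    -- a nilpotent filtration of depth ≤ n
    (n : ℕ) (F : Fin (n + 1) → Submodule k M)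
    (hbot : F 0 = ⊥) (htop : F (Fin.last n) = ⊤)
    (hfil : ∀ (i : Fin n) (x : M), x ∈ F i.succ →
      ρ x - x ⊗ₜ[k] (1 : H) ∈ LinearMap.range (LinearMap.rTensor H (F i.castSucc).subtype)) :
    ∀ x : M, ρ x ∈ LinearMap.range
      (LinearMap.lTensor M (conilpotencyFiltration k H 1 (n - 1)).subtype) := by
  have hlower : ∀ (l : List (Module.Dual k H)), (∀ f ∈ l, f 1 = 0) →
      ∀ (i : ℕ) (hi : i + l.length ≤ n) (x : M), x ∈ F ⟨i + l.length, by omega⟩ →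
        dualAction k ρ (l.foldr (dualConv k H) Coalgebra.counit) x ∈ F ⟨i, by omega⟩ := by
    intro l
    induction l with
    | nil =>
      intro _ i _ x hx
      have hid : dualAction k ρ Coalgebra.counit = LinearMap.id := counit_coaction
      simpa [hid] using hx
    | cons f l ih =>
      intro hl i hi x hx
      rw [List.length_cons] at hi
      rw [List.foldr_cons, dualAction_dualConv k ρ coassoc, LinearMap.comp_apply]
      refine dualAction_mem_of_sub_mem k ρ 1 _ f (hl f (by simp)) _ (hfil ⟨i, by omega⟩ _ ?_)
      refine ih (fun f' hf' => hl f' (by simp [hf'])) (i + 1) (by omega) x ?_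
      convert hx using 3
      simp only [List.length_cons]
      omega
  intro x
  obtain _ | n := n
  · have hx : x ∈ F 0 := htop ▸ Submodule.mem_top
    rw [hbot, Submodule.mem_bot] at hx
    simp [hx]
  refine mem_range_lTensor_of_forall_slice_eq_zero k _
    {φ | ∃ f : Fin (n + 1) → Module.Dual k H, (∀ i, f i 1 = 0) ∧ φ = dualConvProd k H f}
    (fun h hh => ?_) _ ?_
  · simp only [conilpotencyFiltration, Submodule.mem_iInf, LinearMap.mem_ker]
    exact fun f hf => hh _ ⟨f, hf, rfl⟩
  · rintro _ ⟨f, hf, rfl⟩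
    have hmem := hlower (List.ofFn f) (List.forall_mem_ofFn_iff.mpr hf) 0 (by simp) x (by
      have hx : x ∈ F (Fin.last (n + 1)) := htop ▸ Submodule.mem_top
      convert hx using 2
      ext
      simp)
    have hzero : (⟨0, by omega⟩ : Fin (n + 1 + 1)) = 0 := rfl
    rw [hzero, hbot, Submodule.mem_bot] at hmem
    exact hmem
end

section
/- Let V be a finite-dimensional k-vector space and J a subspace of V^⊗2 containing all symmetric tensors v⊗v, v ∈ V. Define T_0 = k, T_1 = V, and for n ≥ 2 let T_n be the kernel of the map T_{n-1} ⊗ V → T_{n-2} ⊗ (V^⊗2/J) (quotienting the last two tensor factors by J). Then ⊕_{n≥0} T_n is a sub-Hopf-algebra of the shuffle Hopf algebra H(V): it is closed under the shuffle product, the deconcatenation coproduct, and the antipode. -/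
open scoped TensorProduct DirectSum

universe u

variable (k : Type u) [Field k] (V : Type u) [AddCommGroup V] [Module k V]

/-- The `n`-th tensor power `V^{⊗n}`. -/
abbrev TPow (n : ℕ) : Type u := PiTensorProduct k (fun _ : Fin n => V)

/-- The underlying graded vector space `⊕_{n ≥ 0} V^{⊗n}` of the tensor (shuffle)
Hopf algebra. -/
abbrev ShuffleCarrier : Type u := ⨁ n : ℕ, TPow k V n

/-- The pure tensor `x₁ ⊗ ... ⊗ xₙ`, viewed in degree `n` of `⊕_{n} V^{⊗n}`. -/
noncomputable def el {n : ℕ} (x : Fin n → V) : ShuffleCarrier k V :=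
  DirectSum.lof k ℕ (fun n => TPow k V n) n (PiTensorProduct.tprod k x)

/-- The set of `(m,n)`-shuffles: permutations `σ` of `Fin (m+n)` which are strictly
monotone on the first `m` and on the last `n` indices. -/
def shuffles (m n : ℕ) : Finset (Equiv.Perm (Fin (m + n))) :=
  Finset.univ.filter (fun σ =>
    (∀ i j : Fin (m + n), i < j → j.1 < m → σ i < σ j) ∧
    (∀ i j : Fin (m + n), i < j → m ≤ i.1 → σ i < σ j))

/-- The value of the shuffle product on a pair of pure tensors. -/
noncomputable def shuffleMulValue {m n : ℕ} (x : Fin m → V) (y : Fin n → V) :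
    ShuffleCarrier k V :=
  ∑ σ ∈ shuffles m n, el k V (fun i => Fin.append x y (σ⁻¹ i))

/-- The value of the deconcatenation coproduct on a pure tensor. -/
noncomputable def deconcatValue {n : ℕ} (x : Fin n → V) :
    ShuffleCarrier k V ⊗[k] ShuffleCarrier k V :=
  ∑ i : Fin (n + 1),
    (el k V (fun j : Fin i.1 => x ⟨j.1, lt_of_lt_of_le j.isLt (Nat.lt_succ_iff.mp i.isLt)⟩)) ⊗ₜ[k]
    (el k V (fun j : Fin (n - i.1) => x ⟨i.1 + j.1, by
        have h1 := j.isLt; have h2 := i.isLt; omega⟩))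

/-- The canonical splitting `V^{⊗(m+n)} ≅ V^{⊗m} ⊗ V^{⊗n}`. -/
noncomputable def tpowSplit (m n : ℕ) : TPow k V (m + n) ≃ₗ[k] TPow k V m ⊗[k] TPow k V n :=
  (PiTensorProduct.reindex k (fun _ : Fin (m + n) => V) finSumFinEquiv.symm).trans
    (PiTensorProduct.tmulEquiv k V).symm

/-- The canonical isomorphism `V^{⊗1} ≅ V`. -/
noncomputable def tpowOne : TPow k V 1 ≃ₗ[k] V :=
  PiTensorProduct.subsingletonEquiv 0

/-- The canonical isomorphism `V^{⊗2} ≅ V ⊗ V`. -/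
noncomputable def tpowTwo : TPow k V 2 ≃ₗ[k] V ⊗[k] V :=
  (tpowSplit k V 1 1).trans (TensorProduct.congr (tpowOne k V) (tpowOne k V))

/-- The graded piece of the shuffle product, `V^{⊗m} ⊗ V^{⊗n} → V^{⊗(m+n)}`:
the sum over all `(m,n)`-shuffles of the concatenation followed by the
corresponding permutation of the tensor factors. -/
noncomputable def gradedShuffleMul (m n : ℕ) :
    TPow k V m ⊗[k] TPow k V n →ₗ[k] TPow k V (m + n) :=
  ∑ σ ∈ shuffles m n,
    (PiTensorProduct.reindex k (fun _ : Fin (m + n) => V) (σ : Fin (m + n) ≃ Fin (m + n))).toLinearMap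
      ∘ₗ (tpowSplit k V m n).symm.toLinearMap

variable (J : Submodule k (V ⊗[k] V))

/-- The spaces `Tₙ` of Lemma 2.14: `T₀ = k`, `T₁ = V`, and `T_{n+2}` is the kernel of
the natural map `T_{n+1} ⊗ V → Tₙ ⊗ (V^{⊗2}/J)`, i.e. the subspace of `V^{⊗(n+2)}`
of elements lying in `T_{n+1} ⊗ V` whose image under the quotient by `J` in the last
two factors vanishes in `Tₙ ⊗ (V^{⊗2}/J)` (equivalently, in `V^{⊗n} ⊗ (V^{⊗2}/J)`). -/
noncomputable def quadT : (n : ℕ) → Submodule k (TPow k V n)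
  | 0 => ⊤
  | 1 => ⊤
  | (n + 2) =>
      (Submodule.comap (tpowSplit k V (n + 1) 1).toLinearMap
        (LinearMap.range (LinearMap.rTensor (TPow k V 1) (quadT (n + 1)).subtype))) ⊓
      (LinearMap.ker ((LinearMap.lTensor (TPow k V n)
          (J.mkQ ∘ₗ (tpowTwo k V).toLinearMap)) ∘ₗ (tpowSplit k V n 2).toLinearMap))

section Slices

open Module

variable {k : Type*} [Field k] {M N P κ : Type*} [AddCommGroup M] [Module k M]
  [AddCommGroup N] [Module k N] [AddCommGroup P] [Module k P]

theorem TensorProduct.eq_zero_iff_rid_lTensor_coord (c : Basis κ k N) (s : M ⊗[k] N) :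
    s = 0 ↔ ∀ j, TensorProduct.rid k M (LinearMap.lTensor M (c.coord j) s) = 0 := by
  classical
  refine ⟨by rintro rfl; simp, fun h => ?_⟩
  apply (TensorProduct.equivFinsuppOfBasisRight c).injective
  ext j
  rw [map_zero, Finsupp.zero_apply, ← h j]
  clear h
  induction s with
  | zero => simp
  | add x y hx hy => simp [hx, hy]
  | tmul x y => simp

theorem TensorProduct.mem_range_rTensor_subtype_iff (c : Basis κ k N) (S : Submodule k M)
    (s : M ⊗[k] N) :
    s ∈ LinearMap.range (LinearMap.rTensor N S.subtype) ↔
      ∀ j, TensorProduct.rid k M (LinearMap.lTensor M (c.coord j) s) ∈ S := by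
  have hex := rTensor_exact N (LinearMap.exact_subtype_mkQ S) S.mkQ_surjective
  rw [← LinearMap.exact_iff.mp hex, LinearMap.mem_ker,
    TensorProduct.eq_zero_iff_rid_lTensor_coord c]
  refine forall_congr' fun j => ?_
  suffices h : TensorProduct.rid k _ (LinearMap.lTensor _ (c.coord j)
      (LinearMap.rTensor N S.mkQ s)) =
      S.mkQ (TensorProduct.rid k M (LinearMap.lTensor M (c.coord j) s)) by
    rw [h, Submodule.mkQ_apply, Submodule.Quotient.mk_eq_zero]
  induction s with
  | zero => simp
  | add x y hx hy => simp only [map_add, hx, hy]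
  | tmul x y => simp

theorem TensorProduct.lTensor_eq_zero_iff (c : Basis κ k M) (g : N →ₗ[k] P) (s : M ⊗[k] N) :
    LinearMap.lTensor M g s = 0 ↔
      ∀ j, g (TensorProduct.lid k N (LinearMap.rTensor N (c.coord j) s)) = 0 := by
  rw [← (TensorProduct.comm k M P).map_eq_zero_iff,
    TensorProduct.eq_zero_iff_rid_lTensor_coord c]
  refine forall_congr' fun j => ?_
  suffices h : TensorProduct.rid k P (LinearMap.lTensor P (c.coord j)
      (TensorProduct.comm k M P (LinearMap.lTensor M g s))) =
      g (TensorProduct.lid k N (LinearMap.rTensor N (c.coord j) s)) by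
    rw [h]
  induction s with
  | zero => simp
  | add x y hx hy => simp only [map_add, hx, hy]
  | tmul x y => simp

theorem TensorProduct.mem_range_lTensor_subtype_iff (c : Basis κ k M) (S : Submodule k N)
    (s : M ⊗[k] N) :
    s ∈ LinearMap.range (LinearMap.lTensor M S.subtype) ↔
      ∀ j, TensorProduct.lid k N (LinearMap.rTensor N (c.coord j) s) ∈ S := by
  have hex := lTensor_exact M (LinearMap.exact_subtype_mkQ S) S.mkQ_surjective
  rw [← LinearMap.exact_iff.mp hex, LinearMap.mem_ker, TensorProduct.lTensor_eq_zero_iff c]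
  simp

theorem TensorProduct.mem_range_map_subtype (S : Submodule k M) (S' : Submodule k N)
    {s : M ⊗[k] N} (hS : s ∈ LinearMap.range (LinearMap.rTensor N S.subtype))
    (hS' : s ∈ LinearMap.range (LinearMap.lTensor M S'.subtype)) :
    s ∈ LinearMap.range (TensorProduct.map S.subtype S'.subtype) := by
  obtain ⟨u, rfl⟩ := hS'
  have hex (N : Type _) [AddCommGroup N] [Module k N] :=
    LinearMap.exact_iff.mp (rTensor_exact N (LinearMap.exact_subtype_mkQ S) S.mkQ_surjective)
  have hu : LinearMap.rTensor S' S.mkQ u = 0 := by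
    apply Module.Flat.lTensor_preserves_injective_linearMap (M := M ⧸ S) S'.subtype
      S'.subtype_injective
    rw [map_zero, ← LinearMap.comp_apply, LinearMap.lTensor_comp_rTensor,
      ← LinearMap.rTensor_comp_lTensor, LinearMap.comp_apply]
    rwa [← hex, LinearMap.mem_ker] at hS
  rw [← LinearMap.mem_ker, hex] at hu
  obtain ⟨v, rfl⟩ := hu
  exact ⟨v, by rw [← LinearMap.comp_apply, LinearMap.lTensor_comp_rTensor]⟩

end Slices

section Coordinates

open Module

variable {k V} {ι : Type*} (b : Basis ι k V)

/-- The coordinate of a tensor in the basis of pure tensors of basis vectors. -/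
noncomputable def TPow.coeff {n : ℕ} (t : TPow k V n) (w : Fin n → ι) : k :=
  (Basis.piTensorProduct fun _ : Fin n => b).repr t w

namespace TPow

variable {n m l : ℕ}

@[simp]
theorem coeff_add (s t : TPow k V n) (w : Fin n → ι) :
    coeff b (s + t) w = coeff b s w + coeff b t w := by simp [coeff]

@[simp]
theorem coeff_smul (r : k) (t : TPow k V n) (w : Fin n → ι) :
    coeff b (r • t) w = r * coeff b t w := by simp [coeff]

@[simp]
theorem coeff_sum {α : Type*} (S : Finset α) (f : α → TPow k V n) (w : Fin n → ι) :
    coeff b (∑ i ∈ S, f i) w = ∑ i ∈ S, coeff b (f i) w := by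
  simp [coeff, Finsupp.finsetSum_apply]

@[simp]
theorem coeff_tprod (x : Fin n → V) (w : Fin n → ι) :
    coeff b (PiTensorProduct.tprod k x) w = ∏ i, b.repr (x i) (w i) := by
  simp [coeff]

theorem coeff_reindex (σ : Equiv.Perm (Fin n)) (t : TPow k V n) (w : Fin n → ι) :
    coeff b (PiTensorProduct.reindex k (fun _ : Fin n => V) σ t) w = coeff b t (w ∘ σ) := by
  induction t using PiTensorProduct.induction_on with
  | smul_tprod r x =>
    rw [map_smul, coeff_smul, coeff_smul]
    congr 1
    erw [PiTensorProduct.reindex_tprod]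
    rw [coeff_tprod, coeff_tprod]
    exact Fintype.prod_equiv σ.symm _ _ fun i => by simp
  | add x y hx hy => simp only [map_add, coeff_add, hx, hy]

theorem tpowSplit_tprod (x : Fin (m + l) → V) :
    tpowSplit k V m l (PiTensorProduct.tprod k x) =
      PiTensorProduct.tprod k (x ∘ Fin.castAdd l) ⊗ₜ[k]
        PiTensorProduct.tprod k (x ∘ Fin.natAdd m) := by
  simp only [tpowSplit, LinearEquiv.trans_apply]
  erw [PiTensorProduct.reindex_tprod]
  erw [PiTensorProduct.tmulEquiv_symm_apply]
  rfl

theorem coeff_rid_lTensor_tpowSplit (t : TPow k V (m + l)) (w : Fin m → ι) (w' : Fin l → ι) :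
    coeff b (TensorProduct.rid k _ (LinearMap.lTensor _
      ((Basis.piTensorProduct fun _ : Fin l => b).coord w') (tpowSplit k V m l t))) w =
      coeff b t (Fin.append w w') := by
  induction t using PiTensorProduct.induction_on with
  | smul_tprod r x =>
    simp only [map_smul, coeff_smul, tpowSplit_tprod]
    simp [Fin.prod_univ_add, mul_comm]
  | add x y hx hy => simp only [map_add, coeff_add, hx, hy]

theorem coeff_lid_rTensor_tpowSplit (t : TPow k V (m + l)) (w : Fin m → ι) (w' : Fin l → ι) :
    coeff b (TensorProduct.lid k _ (LinearMap.rTensor _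
      ((Basis.piTensorProduct fun _ : Fin m => b).coord w) (tpowSplit k V m l t))) w' =
      coeff b t (Fin.append w w') := by
  induction t using PiTensorProduct.induction_on with
  | smul_tprod r x =>
    simp only [map_smul, coeff_smul, tpowSplit_tprod]
    simp [Fin.prod_univ_add]
  | add x y hx hy => simp only [map_add, coeff_add, hx, hy]

theorem coeff_tpowSplit_symm_tmul (x : TPow k V m) (y : TPow k V l) (w : Fin (m + l) → ι) :
    coeff b ((tpowSplit k V m l).symm (x ⊗ₜ[k] y)) w =
      coeff b x (w ∘ Fin.castAdd l) * coeff b y (w ∘ Fin.natAdd m) := by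
  have h := coeff_rid_lTensor_tpowSplit b ((tpowSplit k V m l).symm (x ⊗ₜ[k] y))
    (w ∘ Fin.castAdd l) (w ∘ Fin.natAdd m)
  rw [LinearEquiv.apply_symm_apply] at h
  have hw : Fin.append (w ∘ Fin.castAdd l) (w ∘ Fin.natAdd m) = w := Fin.append_castAdd_natAdd
  rw [hw] at h
  rw [← h]
  simp [mul_comm, coeff]

theorem apply_tpowTwo [Fintype ι] (φ : Dual k (V ⊗[k] V)) (u : TPow k V 2) :
    φ (tpowTwo k V u) = ∑ a, ∑ a', φ (b a ⊗ₜ b a') * coeff b u ![a, a'] := by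
  induction u using PiTensorProduct.induction_on with
  | smul_tprod r x =>
    have h : tpowTwo k V (PiTensorProduct.tprod k x) = x 0 ⊗ₜ[k] x 1 := by
      simp only [tpowTwo, LinearEquiv.trans_apply]
      rw [tpowSplit_tprod (m := 1) (l := 1)]
      simp only [TensorProduct.congr_tmul, tpowOne]
      erw [PiTensorProduct.subsingletonEquiv_apply_tprod]
      erw [PiTensorProduct.subsingletonEquiv_apply_tprod]
      rfl
    have hφ : φ (x 0 ⊗ₜ[k] x 1) =
        ∑ a, ∑ a', φ (b a ⊗ₜ b a') * (b.repr (x 0) a * b.repr (x 1) a') := by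
      conv_lhs => rw [← b.sum_repr (x 0), ← b.sum_repr (x 1)]
      simp only [TensorProduct.sum_tmul, TensorProduct.tmul_sum, ← TensorProduct.smul_tmul',
        TensorProduct.tmul_smul, map_sum, map_smul, smul_eq_mul,
        Finset.mul_sum]
      rw [Finset.sum_comm]
      refine Finset.sum_congr rfl fun a _ => Finset.sum_congr rfl fun a' _ => ?_
      ring
    rw [map_smul, map_smul, h, hφ, smul_eq_mul, Finset.mul_sum]
    refine Finset.sum_congr rfl fun a _ => ?_
    rw [Finset.mul_sum]
    refine Finset.sum_congr rfl fun a' _ => ?_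
    simp only [coeff_smul, coeff_tprod, Fin.prod_univ_two, Matrix.cons_val_zero,
      Matrix.cons_val_one]
    ring
  | add x y hx hy => simp only [map_add, coeff_add, hx, hy, mul_add, Finset.sum_add_distrib]

end TPow

end Coordinates

section Combinatorics

variable {k} {ι : Type*} {m n : ℕ}

theorem Function.update_append_castAdd (u : Fin m → ι) (v : Fin n → ι) (i : Fin m) (a : ι) :
    Function.update (Fin.append u v) (Fin.castAdd n i) a =
      Fin.append (Function.update u i a) v := by
  ext j
  refine Fin.addCases (fun j => ?_) (fun j => ?_) j
  · simp [Function.update_apply]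
  · simp [Function.update_apply, Fin.ext_iff]
    omega

theorem Function.update_append_natAdd (u : Fin m → ι) (v : Fin n → ι) (i : Fin n) (a : ι) :
    Function.update (Fin.append u v) (Fin.natAdd m i) a =
      Fin.append u (Function.update v i a) := by
  ext j
  refine Fin.addCases (fun j => ?_) (fun j => ?_) j
  · simp [Function.update_apply, Fin.ext_iff]
    omega
  · simp [Function.update_apply]

variable [Fintype ι]

/-- Contraction of the slots `p` and `q` of a coordinate array against `β`. -/
def contract (β : ι → ι → k) (c : (Fin n → ι) → k) (p q : Fin n) (w : Fin n → ι) : k :=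
  ∑ a, ∑ a', β a a' * c (Function.update (Function.update w p a) q a')

/-- All contractions of two consecutive slots against elements of `A` vanish. -/
def ConsecutiveContractionsVanish (A : Set (ι → ι → k)) (c : (Fin n → ι) → k) : Prop :=
  ∀ p q : Fin n, q.1 = p.1 + 1 → ∀ β ∈ A, ∀ w, contract β c p q w = 0

theorem contract_append_left (β : ι → ι → k) (c : (Fin (m + n) → ι) → k) (p q : Fin m)
    (u : Fin m → ι) (v : Fin n → ι) :
    contract β (fun u => c (Fin.append u v)) p q u =
      contract β c (Fin.castAdd n p) (Fin.castAdd n q) (Fin.append u v) := by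
  simp [contract, Function.update_append_castAdd]

theorem contract_append_right (β : ι → ι → k) (c : (Fin (m + n) → ι) → k) (p q : Fin n)
    (u : Fin m → ι) (v : Fin n → ι) :
    contract β (fun v => c (Fin.append u v)) p q v =
      contract β c (Fin.natAdd m p) (Fin.natAdd m q) (Fin.append u v) := by
  simp [contract, Function.update_append_natAdd]

theorem contract_swap (β : ι → ι → k) (hβ : ∀ a a', β a a' = -β a' a)
    (c : (Fin n → ι) → k) {p q : Fin n} (hpq : p ≠ q) (w : Fin n → ι) :
    contract β c q p w = -contract β c p q w := by
  unfold contract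
  rw [Finset.sum_comm, ← Finset.sum_neg_distrib]
  refine Finset.sum_congr rfl fun a _ => ?_
  rw [← Finset.sum_neg_distrib]
  refine Finset.sum_congr rfl fun a' _ => ?_
  rw [Function.update_comm hpq.symm, hβ, neg_mul]

theorem contract_comp_perm (β : ι → ι → k) (c : (Fin n → ι) → k) (σ : Equiv.Perm (Fin n))
    (p q : Fin n) (w : Fin n → ι) :
    contract β (fun w => c (w ∘ σ)) (σ p) (σ q) w = contract β c p q (w ∘ σ) := by
  simp [contract, Function.update_comp_eq_of_injective _ σ.injective]

theorem contract_sum {α : Type*} (β : ι → ι → k) (S : Finset α)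
    (c : α → (Fin n → ι) → k) (p q : Fin n) (w : Fin n → ι) :
    contract β (fun w => ∑ i ∈ S, c i w) p q w = ∑ i ∈ S, contract β (c i) p q w := by
  simp only [contract, Finset.mul_sum]
  rw [Finset.sum_comm (s := S)]
  refine Finset.sum_congr rfl fun a _ => ?_
  rw [Finset.sum_comm]

theorem contract_comp_swap (β : ι → ι → k) (c : (Fin n → ι) → k) (p q : Fin n)
    (w : Fin n → ι) : contract β c p q (w ∘ Equiv.swap p q) = contract β c p q w := by
  unfold contract
  refine Finset.sum_congr rfl fun a _ => Finset.sum_congr rfl fun a' _ => ?_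
  congr 2
  ext j
  by_cases hq : j = q
  · simp [hq]
  by_cases hp : j = p
  · subst hp
    simp [Function.update_of_ne hq]
  simp [Function.update_of_ne hq, Function.update_of_ne hp, Equiv.swap_apply_of_ne_of_ne hp hq]

theorem contract_concat_left (β : ι → ι → k) (x : (Fin m → ι) → k) (y : (Fin n → ι) → k)
    (p q : Fin m) (w : Fin (m + n) → ι) :
    contract β (fun w => x (w ∘ Fin.castAdd n) * y (w ∘ Fin.natAdd m))
        (Fin.castAdd n p) (Fin.castAdd n q) w =
      contract β x p q (w ∘ Fin.castAdd n) * y (w ∘ Fin.natAdd m) := by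
  have hne (i : Fin m) (j : Fin n) : Fin.natAdd m j ≠ Fin.castAdd n i := by
    simp [Fin.ext_iff]
    omega
  simp only [contract, Finset.sum_mul,
    Function.update_comp_eq_of_injective _ (Fin.castAdd_injective m n),
    Function.update_comp_eq_of_forall_ne _ _ (hne _), mul_assoc]

theorem contract_concat_right (β : ι → ι → k) (x : (Fin m → ι) → k) (y : (Fin n → ι) → k)
    (p q : Fin n) (w : Fin (m + n) → ι) :
    contract β (fun w => x (w ∘ Fin.castAdd n) * y (w ∘ Fin.natAdd m))
        (Fin.natAdd m p) (Fin.natAdd m q) w =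
      x (w ∘ Fin.castAdd n) * contract β y p q (w ∘ Fin.natAdd m) := by
  have hne (i : Fin n) (j : Fin m) : Fin.castAdd n j ≠ Fin.natAdd m i := by
    simp [Fin.ext_iff]
    omega
  simp only [contract, Finset.mul_sum,
    Function.update_comp_eq_of_injective _ (Fin.natAdd_injective n m),
    Function.update_comp_eq_of_forall_ne _ _ (hne _), mul_left_comm]

theorem swap_mul_mem_shuffles {σ : Equiv.Perm (Fin (m + n))} (hσ : σ ∈ shuffles m n)
    {p q : Fin (m + n)} (hpq : q.1 = p.1 + 1)
    (hcross : ¬((σ⁻¹ p).1 < m ↔ (σ⁻¹ q).1 < m)) :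
    Equiv.swap p q * σ ∈ shuffles m n := by
  have key (i j : Fin (m + n)) (h : σ i < σ j) (hij : i.1 < m ↔ j.1 < m) :
      Equiv.swap p q (σ i) < Equiv.swap p q (σ j) := by
    have hne : ¬(σ i = p ∧ σ j = q) := by
      rintro ⟨rfl, rfl⟩
      simp [hij] at hcross
    simp only [Equiv.swap_apply_def]
    split_ifs <;> simp only [Fin.ext_iff, Fin.lt_def] at * <;> omega
  simp only [shuffles, Finset.mem_filter, Finset.mem_univ, true_and, Equiv.Perm.mul_apply]
    at hσ ⊢
  refine ⟨fun i j hij hj => key i j (hσ.1 i j hij hj) ?_,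
    fun i j hij hi => key i j (hσ.2 i j hij hi) ?_⟩ <;> rw [Fin.lt_def] at hij <;> omega

theorem inv_consecutive_of_mem_shuffles {σ : Equiv.Perm (Fin (m + n))} (hσ : σ ∈ shuffles m n)
    {p q : Fin (m + n)} (hpq : q.1 = p.1 + 1) (hside : (σ⁻¹ p).1 < m ↔ (σ⁻¹ q).1 < m) :
    (σ⁻¹ q).1 = (σ⁻¹ p).1 + 1 := by
  simp only [shuffles, Finset.mem_filter, Finset.mem_univ, true_and] at hσ
  have mono (i j : Fin (m + n)) (hij : i < j) (h : i.1 < m ↔ j.1 < m) : σ i < σ j := by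
    by_cases hj : j.1 < m
    · exact hσ.1 i j hij hj
    · exact hσ.2 i j hij (by omega)
  obtain ⟨i, rfl⟩ := σ.surjective p
  obtain ⟨j, rfl⟩ := σ.surjective q
  simp only [Equiv.Perm.inv_def, Equiv.symm_apply_apply] at hside ⊢
  rcases lt_trichotomy i j with h | h | h
  · by_contra hne
    rw [Fin.lt_def] at h
    let r : Fin (m + n) := ⟨i.1 + 1, by omega⟩
    have h1 : σ i < σ r := mono i r (by simp [Fin.lt_def, r]) (by simp only [r]; omega)
    have h2 : σ r < σ j := mono r j (by simp only [Fin.lt_def, r]; omega) (by simp only [r]; omega)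
    rw [Fin.lt_def] at h1 h2
    omega
  · subst h
    omega
  · have := mono j i h hside.symm
    rw [Fin.lt_def] at this
    omega

theorem ConsecutiveContractionsVanish.shuffle {A : Set (ι → ι → k)}
    (hA : ∀ β ∈ A, ∀ a a', β a a' = -β a' a) {x : (Fin m → ι) → k} {y : (Fin n → ι) → k}
    (hx : ConsecutiveContractionsVanish A x) (hy : ConsecutiveContractionsVanish A y) :
    ConsecutiveContractionsVanish A fun w : Fin (m + n) → ι => ∑ σ ∈ shuffles m n,
      x ((w ∘ σ) ∘ Fin.castAdd n) * y ((w ∘ σ) ∘ Fin.natAdd m) := by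
  classical
  intro p q hpq β hβ w
  have hne : p ≠ q := by
    rintro rfl
    omega
  rw [contract_sum]
  set z : (Fin (m + n) → ι) → k := fun w => x (w ∘ Fin.castAdd n) * y (w ∘ Fin.natAdd m) with hz
  change ∑ σ ∈ shuffles m n, contract β (fun w => z (w ∘ σ)) p q w = 0
  have hside : ∀ σ ∈ shuffles m n, ((σ⁻¹ p).1 < m ↔ (σ⁻¹ q).1 < m) →
      contract β (fun w => z (w ∘ σ)) p q w = 0 := by
    intro σ hσ h
    have hcons := inv_consecutive_of_mem_shuffles hσ hpq h
    have hσz := contract_comp_perm β z σ (σ⁻¹ p) (σ⁻¹ q) w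
    simp only [Equiv.Perm.inv_def, Equiv.apply_symm_apply] at hσz
    rw [hσz]
    generalize σ⁻¹ p = p' at *
    generalize σ⁻¹ q = q' at *
    induction p' using Fin.addCases with
    | left i =>
      induction q' using Fin.addCases with
      | left j => rw [hz, contract_concat_left, hx i j (by simpa using hcons) β hβ, zero_mul]
      | right j => simp at h
    | right i =>
      induction q' using Fin.addCases with
      | left j => simp at h
      | right j =>
        rw [hz, contract_concat_right,
          hy i j (by simp only [Fin.val_natAdd] at hcons; omega) β hβ, mul_zero]
  rw [← Finset.sum_filter_of_ne (p := fun σ => ¬((σ⁻¹ p).1 < m ↔ (σ⁻¹ q).1 < m))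
    fun σ hσ h0 h => h0 (hside σ hσ h)]
  refine Finset.sum_involution (fun σ _ => Equiv.swap p q * σ) ?_ ?_ ?_ ?_
  · intro σ _
    have h := contract_comp_perm β (fun w => z (w ∘ σ)) (Equiv.swap p q) q p w
    rw [Equiv.swap_apply_left, Equiv.swap_apply_right, Equiv.swap_comm, contract_comp_swap,
      contract_swap β (hA β hβ) _ hne, Equiv.swap_comm] at h
    rw [Equiv.Perm.coe_mul]
    exact (congrArg _ h).trans (add_neg_cancel _)
  · intro σ _ _ h
    exact hne (Equiv.swap_eq_one_iff.mp (mul_eq_right.mp h))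
  · intro σ hσ
    rw [Finset.mem_filter] at hσ ⊢
    refine ⟨swap_mul_mem_shuffles hσ.1 hpq hσ.2, ?_⟩
    simpa [iff_comm] using hσ.2
  · intro σ _
    simp

theorem ConsecutiveContractionsVanish.rev {A : Set (ι → ι → k)}
    (hA : ∀ β ∈ A, ∀ a a', β a a' = -β a' a) {x : (Fin n → ι) → k}
    (hx : ConsecutiveContractionsVanish A x) :
    ConsecutiveContractionsVanish A fun w => x (w ∘ Fin.revPerm) := by
  intro p q hpq β hβ w
  have h := contract_comp_perm β x Fin.revPerm p.rev q.rev w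
  simp only [Fin.revPerm_apply, Fin.rev_rev] at h
  rw [h, contract_swap β (hA β hβ) x (by simp [Fin.ext_iff]; omega),
    hx _ _ (by simp only [Fin.val_rev]; omega) β hβ, neg_zero]

theorem ConsecutiveContractionsVanish.append_left {A : Set (ι → ι → k)}
    {x : (Fin (m + n) → ι) → k} (hx : ConsecutiveContractionsVanish A x) (v : Fin n → ι) :
    ConsecutiveContractionsVanish A fun u => x (Fin.append u v) := by
  intro p q hpq β hβ w
  rw [contract_append_left]
  exact hx _ _ hpq β hβ _

theorem ConsecutiveContractionsVanish.append_right {A : Set (ι → ι → k)}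
    {x : (Fin (m + n) → ι) → k} (hx : ConsecutiveContractionsVanish A x) (u : Fin m → ι) :
    ConsecutiveContractionsVanish A fun v => x (Fin.append u v) := by
  intro p q hpq β hβ w
  rw [contract_append_right]
  exact hx _ _ (by simp only [Fin.val_natAdd]; omega) β hβ _

theorem consecutiveContractionsVanish_add_two_iff {A : Set (ι → ι → k)}
    {x : (Fin (n + 2) → ι) → k} :
    ConsecutiveContractionsVanish A x ↔
      (∀ v : Fin 1 → ι, ConsecutiveContractionsVanish A
        fun u => x (Fin.append (m := n + 1) (n := 1) u v)) ∧
      ∀ u : Fin n → ι, ∀ β ∈ A, ∑ a, ∑ a', β a a' * x (Fin.append u ![a, a']) = 0 := by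
  have hlast (u : Fin n → ι) (v : Fin 2 → ι) (β : ι → ι → k) :
      contract β x (Fin.natAdd n 0) (Fin.natAdd n 1) (Fin.append u v) =
        ∑ a, ∑ a', β a a' * x (Fin.append u ![a, a']) := by
    rw [← contract_append_right]
    refine Finset.sum_congr rfl fun a _ => Finset.sum_congr rfl fun a' _ => ?_
    congr 3
    ext j
    fin_cases j <;> simp
  refine ⟨fun h => ⟨fun v => h.append_left (m := n + 1) (n := 1) v, fun u β hβ => ?_⟩,
    fun ⟨h1, h2⟩ p q hpq β hβ w => ?_⟩
  · rcases isEmpty_or_nonempty ι with hι | ⟨⟨i⟩⟩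
    · simp
    · rw [← hlast u fun _ => i]
      exact h _ _ rfl β hβ _
  · by_cases hq : q.1 < n + 1
    · have h := h1 (w ∘ Fin.natAdd (n + 1)) ⟨p.1, by omega⟩ ⟨q.1, hq⟩ hpq β hβ
        (w ∘ Fin.castAdd 1)
      rw [contract_append_left (m := n + 1) (n := 1)] at h
      have hw : Fin.append (m := n + 1) (n := 1) (w ∘ Fin.castAdd 1)
          (w ∘ Fin.natAdd (n + 1)) = w :=
        Fin.append_castAdd_natAdd (m := n + 1) (n := 1)
      rw [hw] at h
      exact h
    · have hp : p = Fin.natAdd n 0 := by ext; simp; omega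
      have hq : q = Fin.natAdd n 1 := by ext; simp; omega
      have hw : Fin.append (w ∘ Fin.castAdd 2) (w ∘ Fin.natAdd n) = w :=
        Fin.append_castAdd_natAdd
      rw [hp, hq, ← hw, hlast]
      exact h2 _ β hβ

end Combinatorics

section Membership

open Module

variable {k V} {ι : Type*} (b : Basis ι k V) {J}

/-- The matrices in the basis `b` of the bilinear forms vanishing on `J`. -/
def annihilatorMatrices (J : Submodule k (V ⊗[k] V)) : Set (ι → ι → k) :=
  {β | ∃ φ ∈ J.dualAnnihilator, β = fun a a' => φ (b a ⊗ₜ b a')}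

theorem annihilatorMatrices_antisymm (hJ : ∀ v : V, v ⊗ₜ[k] v ∈ J) :
    ∀ β ∈ annihilatorMatrices b J, ∀ a a', β a a' = -β a' a := by
  rintro _ ⟨φ, hφ, rfl⟩ a a'
  rw [Submodule.mem_dualAnnihilator] at hφ
  have h := hφ _ (hJ (b a + b a'))
  simp only [TensorProduct.add_tmul, TensorProduct.tmul_add, map_add, hφ _ (hJ _)] at h
  linear_combination h

theorem mem_quadT_iff [Fintype ι] : ∀ {n : ℕ} {t : TPow k V n}, t ∈ quadT k V J n ↔
    ConsecutiveContractionsVanish (annihilatorMatrices b J) (TPow.coeff b t)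
  | 0, t => by
    simp only [quadT, Submodule.mem_top, true_iff]
    intro p
    exact p.elim0
  | 1, t => by
    simp only [quadT, Submodule.mem_top, true_iff]
    intro p q hpq
    omega
  | n + 2, t => by
    rw [consecutiveContractionsVanish_add_two_iff, quadT, Submodule.mem_inf,
      Submodule.mem_comap, LinearMap.mem_ker, LinearMap.comp_apply]
    refine and_congr ?_ ?_
    · rw [TensorProduct.mem_range_rTensor_subtype_iff (Basis.piTensorProduct fun _ : Fin 1 => b)]
      refine forall_congr' fun v => ?_
      rw [mem_quadT_iff]
      refine iff_of_eq (congrArg _ (funext fun u => ?_))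
      exact TPow.coeff_rid_lTensor_tpowSplit b (m := n + 1) (l := 1) t u v
    · rw [TensorProduct.lTensor_eq_zero_iff (Basis.piTensorProduct fun _ : Fin n => b)]
      refine forall_congr' fun u => ?_
      rw [LinearMap.comp_apply, Submodule.mkQ_apply, Submodule.Quotient.mk_eq_zero,
        ← Subspace.forall_mem_dualAnnihilator_apply_eq_zero_iff]
      have h (φ : Dual k (V ⊗[k] V)) := TPow.apply_tpowTwo b φ (TensorProduct.lid k _
        (LinearMap.rTensor _ ((Basis.piTensorProduct fun _ : Fin n => b).coord u)
          (tpowSplit k V n 2 t)))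
      simp only [TPow.coeff_lid_rTensor_tpowSplit] at h
      constructor
      · rintro H _ ⟨φ, hφ, rfl⟩
        exact (h φ).symm.trans (H φ hφ)
      · intro H φ hφ
        exact (h φ).trans (H _ ⟨φ, hφ, rfl⟩)

end Membership

/-- **Lemma 2.14**: if `J ⊆ V^{⊗2}` contains all symmetric tensors `v ⊗ v`, then
`⊕_{n≥0} Tₙ` is a sub-Hopf-algebra of the shuffle Hopf algebra `H(V)`: the spaces `Tₙ`
are closed under the shuffle product, the deconcatenation coproduct and the antipode
(reversal of tensor factors). -/
theorem quadT_sub_hopf [CharZero k] [FiniteDimensional k V]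
    (hJ : ∀ v : V, v ⊗ₜ[k] v ∈ J) :
    (∀ (m n : ℕ) (x : TPow k V m) (y : TPow k V n), x ∈ quadT k V J m → y ∈ quadT k V J n →
      gradedShuffleMul k V m n (x ⊗ₜ[k] y) ∈ quadT k V J (m + n)) ∧
    (∀ (m l : ℕ) (x : TPow k V (m + l)), x ∈ quadT k V J (m + l) →
      (tpowSplit k V m l) x ∈ LinearMap.range
        (TensorProduct.map (quadT k V J m).subtype (quadT k V J l).subtype)) ∧
    (∀ (n : ℕ) (x : TPow k V n), x ∈ quadT k V J n →
      (PiTensorProduct.reindex k (fun _ : Fin n => V) (Fin.revPerm : Fin n ≃ Fin n)).toLinearMap x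
        ∈ quadT k V J n) := by
  let b := Module.finBasis k V
  have hA := annihilatorMatrices_antisymm b hJ
  refine ⟨fun m n x y hx hy => ?_, fun m l x hx => ?_, fun n x hx => ?_⟩
  · rw [mem_quadT_iff b] at hx hy ⊢
    convert hx.shuffle hA hy using 1
    ext w
    simp [gradedShuffleMul, TPow.coeff_reindex, TPow.coeff_tpowSplit_symm_tmul]
  · rw [mem_quadT_iff b] at hx
    apply TensorProduct.mem_range_map_subtype
    · rw [TensorProduct.mem_range_rTensor_subtype_iff (Basis.piTensorProduct fun _ : Fin l => b)]
      intro v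
      rw [mem_quadT_iff b]
      convert hx.append_left v using 1
      ext u
      exact TPow.coeff_rid_lTensor_tpowSplit b x u v
    · rw [TensorProduct.mem_range_lTensor_subtype_iff (Basis.piTensorProduct fun _ : Fin m => b)]
      intro u
      rw [mem_quadT_iff b]
      convert hx.append_right u using 1
      ext v
      exact TPow.coeff_lid_rTensor_tpowSplit b x u v
  · rw [mem_quadT_iff b] at hx ⊢
    convert hx.rev hA using 1
    ext w
    exact TPow.coeff_reindex b Fin.revPerm x w
end

section
/- Pro-unipotent (Malcev) completion over a field k of characteristic 0 is right exact: if Γ₁ → Γ₂ → Γ₃ → 1 is an exact sequence of groups, then the induced sequence of pro-unipotent completions Γ₁^{uni} → Γ₂^{uni} → Γ₃^{uni} → 1 is exact (the image of Γ₁^{uni} is the kernel of the faithfully flat map Γ₂^{uni} → Γ₃^{uni}). -/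
open scoped TensorProduct

universe u

variable (k : Type u) [Field k]

/-- A commutative Hopf algebra is *unipotent* (i.e. `Spec` of it is a pro-unipotent
affine group scheme) when it is conilpotent: the conilpotency filtration is
exhaustive. -/
def IsUnipotentHopf (A : Type u) [CommRing A] [HopfAlgebra k A] : Prop :=
  ∀ x : A, ∃ n, x ∈ conilpotencyFiltration k A 1 n

/-- The convolution product of two `k`-points of `Spec A`, for a bialgebra `A`:
this is the group law of the affine group scheme `Spec A` on `A →ₐ[k] k`. -/
noncomputable def convPoint {A : Type u} [CommRing A] [HopfAlgebra k A]
    (φ ψ : A →ₐ[k] k) : A →ₐ[k] k :=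
  (Algebra.TensorProduct.lmul' k).comp
    ((Algebra.TensorProduct.map φ ψ).comp (Bialgebra.comulAlgHom k A))

/-- `(A, η)` is the pro-unipotent completion over `k` of the group `Γ`:
`A` is a commutative unipotent Hopf algebra, `η : Γ → (Spec A)(k)` is a group
homomorphism, and the pair is universal among multiplicative maps from `Γ` to the
`k`-points of unipotent algebraic (i.e. finite type) affine group schemes over `k`. -/
def IsProunipotentCompletion (Γ : Type u) [Group Γ]
    (A : Type u) [CommRing A] [HopfAlgebra k A] (η : Γ → (A →ₐ[k] k)) : Prop :=
  IsUnipotentHopf k A ∧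
  (∀ γ₁ γ₂ : Γ, η (γ₁ * γ₂) = convPoint k (η γ₁) (η γ₂)) ∧
  (∀ (B : Type u) (_ : CommRing B) (_ : HopfAlgebra k B), IsUnipotentHopf k B →
    Algebra.FiniteType k B →
    ∀ ρ : Γ → (B →ₐ[k] k), (∀ γ₁ γ₂ : Γ, ρ (γ₁ * γ₂) = convPoint k (ρ γ₁) (ρ γ₂)) →
    ∃! f : B →ₐc[k] A, ∀ γ : Γ, (η γ).comp (f : B →ₐ[k] A) = ρ γ)

open Coalgebra Bialgebra HopfAlgebra

section Slices

variable {k}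
variable {M N : Type*} [AddCommGroup M] [Module k M] [AddCommGroup N] [Module k N]

theorem tensor_eq_zero_of_separating {P : Set (Module.Dual k M)}
    (hP : ∀ m, (∀ φ ∈ P, φ m = 0) → m = 0) {t : M ⊗[k] N}
    (ht : ∀ φ ∈ P, TensorProduct.lid k N (φ.rTensor N t) = 0) : t = 0 := by
  obtain ⟨b, rfl⟩ := TensorProduct.eq_repr_basis_right (Module.Free.chooseBasis k N) t
  suffices b = 0 by simp [this]
  ext i
  refine hP _ fun φ hφ => ?_
  have h := ht φ hφ
  simp only [Finsupp.sum, map_sum, LinearMap.rTensor_tmul, TensorProduct.lid_tmul] at h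
  by_cases hi : i ∈ b.support
  · exact linearIndependent_iff'.1 (Module.Free.chooseBasis k N).linearIndependent _ _ h i hi
  · simp [Finsupp.notMem_support_iff.1 hi]

theorem tensor_eq_zero_of_slices {t : M ⊗[k] N}
    (ht : ∀ φ : Module.Dual k M, TensorProduct.lid k N (φ.rTensor N t) = 0) : t = 0 :=
  tensor_eq_zero_of_separating (P := Set.univ)
    (fun m hm => (Module.forall_dual_apply_eq_zero_iff k m).1 fun φ => hm φ trivial)
    fun φ _ => ht φ

theorem mem_range_lTensor_of_slices {W : Submodule k N} {t : M ⊗[k] N}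
    (ht : ∀ φ : Module.Dual k M, TensorProduct.lid k N (φ.rTensor N t) ∈ W) :
    t ∈ LinearMap.range (W.subtype.lTensor M) := by
  rw [(lTensor_exact M (LinearMap.exact_subtype_mkQ W) W.mkQ_surjective).linearMap_ker_eq.symm]
  refine tensor_eq_zero_of_slices fun φ => ?_
  have : TensorProduct.lid k (N ⧸ W) (φ.rTensor (N ⧸ W) (W.mkQ.lTensor M t)) =
      W.mkQ (TensorProduct.lid k N (φ.rTensor N t)) := by
    clear ht
    induction t using TensorProduct.induction_on with
    | zero => simp
    | tmul x y => simp
    | add x y hx hy => simp only [map_add, hx, hy]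
  rw [this]
  simpa using ht φ

end Slices

section Comatrix

variable {k} {A : Type u} [AddCommGroup A] [Module k A] [Coalgebra k A]

/-- The action `x ↦ (φ ⊗ id) (Δ x)` of the dual of a coalgebra. -/
noncomputable def leftAct (φ : Module.Dual k A) : A →ₗ[k] A :=
  (TensorProduct.lid k A).toLinearMap ∘ₗ φ.rTensor A ∘ₗ comul

/-- The action `x ↦ (id ⊗ φ) (Δ x)` of the dual of a coalgebra. -/
noncomputable def rightAct (φ : Module.Dual k A) : A →ₗ[k] A :=
  (TensorProduct.rid k A).toLinearMap ∘ₗ φ.lTensor A ∘ₗ comul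

theorem leftAct_counit (x : A) : leftAct (counit (R := k)) x = x := by
  simp [leftAct]

theorem rightAct_counit (x : A) : rightAct (counit (R := k)) x = x := by
  simp [rightAct]

theorem apply_rightAct (φ ψ : Module.Dual k A) (x : A) :
    φ (rightAct ψ x) = dualConv k A φ ψ x := by
  let r := Coalgebra.Repr.arbitrary k x
  simp only [rightAct, dualConv, LinearMap.comp_apply, LinearEquiv.coe_coe]
  rw [← r.eq]
  simp [mul_comm]

theorem apply_leftAct (φ ψ : Module.Dual k A) (x : A) :
    φ (leftAct ψ x) = dualConv k A ψ φ x := by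
  let r := Coalgebra.Repr.arbitrary k x
  simp only [leftAct, dualConv, LinearMap.comp_apply, LinearEquiv.coe_coe]
  rw [← r.eq]
  simp

theorem dualConv_eq_convMul (φ ψ : Module.Dual k A) :
    dualConv k A φ ψ = (WithConv.toConv φ * WithConv.toConv ψ).ofConv := by
  ext x
  let r := Coalgebra.Repr.arbitrary k x
  simp only [dualConv, LinearMap.convMul_def, LinearMap.comp_apply, LinearEquiv.coe_coe]
  rw [← r.eq]
  simp

theorem dualConv_assoc (φ ψ χ : Module.Dual k A) :
    dualConv k A (dualConv k A φ ψ) χ = dualConv k A φ (dualConv k A ψ χ) := by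
  simp [dualConv_eq_convMul, mul_assoc]

theorem leftAct_leftAct (φ ψ : Module.Dual k A) (x : A) :
    leftAct φ (leftAct ψ x) = leftAct (dualConv k A ψ φ) x := by
  rw [← sub_eq_zero, ← Module.forall_dual_apply_eq_zero_iff k]
  intro χ
  simp only [map_sub, apply_leftAct, dualConv_assoc, sub_self]

theorem finiteDimensional_range_leftAct (x : A) :
    ∃ s : Finset A, ∀ φ : Module.Dual k A, leftAct φ x ∈ Submodule.span k (s : Set A) := by
  classical
  let r := Coalgebra.Repr.arbitrary k x
  refine ⟨r.index.image r.right, fun φ => ?_⟩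
  have : leftAct φ x = ∑ i ∈ r.index, φ (r.left i) • r.right i := by
    simp only [leftAct, LinearMap.comp_apply, LinearEquiv.coe_coe]
    rw [← r.eq]
    simp
  rw [this]
  exact Submodule.sum_mem _ fun i hi => Submodule.smul_mem _ _ (Submodule.subset_span (by
    exact Finset.mem_coe.2 (Finset.mem_image_of_mem _ hi)))

/-- A linearly independent family `w` together with a matrix `c` of coefficients such that
`Δ wᵢ = ∑ cᵢⱼ ⊗ wⱼ`. -/
structure IsComatrix {n : ℕ} (w : Fin n → A) (c : Matrix (Fin n) (Fin n) A) : Prop where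
  linearIndependent : LinearIndependent k w
  comul_eq : ∀ i, comul (R := k) (w i) = ∑ j, c i j ⊗ₜ w j

theorem exists_isComatrix (x : A) : ∃ (n : ℕ) (w : Fin n → A) (c : Matrix (Fin n) (Fin n) A),
    IsComatrix (k := k) w c ∧ x ∈ Submodule.span k (Set.range w) ∧
      ∀ i, ∃ φ : Module.Dual k A, leftAct φ x = w i := by
  obtain ⟨s, hs⟩ := finiteDimensional_range_leftAct (k := k) x
  let L : Module.Dual k A →ₗ[k] A :=
    (TensorProduct.lid k A).toLinearMap ∘ₗ (LinearMap.applyₗ (R := k) (comul (R := k) x)) ∘ₗ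
      (LinearMap.rTensorHom A)
  have hL : ∀ φ, L φ = leftAct φ x := fun φ => rfl
  let W := LinearMap.range L
  have hW : W ≤ Submodule.span k (s : Set A) := by
    rintro _ ⟨φ, rfl⟩
    exact hs φ
  have : FiniteDimensional k W := Submodule.finiteDimensional_of_le hW
  let b := Module.finBasis k W
  have hmem : ∀ i, comul (R := k) (b i : A) ∈ LinearMap.range (W.subtype.lTensor A) := by
    intro i
    refine mem_range_lTensor_of_slices fun ψ => ?_
    obtain ⟨φ, hφ⟩ := (b i).2
    refine ⟨dualConv k A φ ψ, ?_⟩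
    rw [hL, ← leftAct_leftAct, ← hL, hφ]
    rfl
  choose t ht using hmem
  choose c hc using fun i => TensorProduct.eq_repr_basis_right b (t i)
  refine ⟨_, fun i => (b i : A), fun i j => c i j, ⟨?_, fun i => ?_⟩, ?_, fun i => ?_⟩
  · exact b.linearIndependent.map' W.subtype (Submodule.ker_subtype W)
  · rw [← ht i, ← hc i, Finsupp.sum_fintype _ _ (by simp)]
    simp
  · have hx : x ∈ W := ⟨counit, by rw [hL, leftAct_counit]⟩
    have h := congrArg W.subtype (b.sum_repr ⟨x, hx⟩)
    rw [map_sum] at h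
    change _ = x at h
    rw [← h]
    exact Submodule.sum_mem _ fun i _ => by
      rw [map_smul]
      exact Submodule.smul_mem _ _ (Submodule.subset_span ⟨i, rfl⟩)
  · obtain ⟨φ, hφ⟩ := (b i).2
    exact ⟨φ, hφ⟩

namespace IsComatrix

variable {n : ℕ} {w : Fin n → A} {c : Matrix (Fin n) (Fin n) A}

theorem leftAct_eq (h : IsComatrix (k := k) w c) (φ : Module.Dual k A) (i : Fin n) :
    leftAct φ (w i) = ∑ j, φ (c i j) • w j := by
  simp [leftAct, h.comul_eq]

theorem counit_eq (h : IsComatrix (k := k) w c) (i j : Fin n) :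
    counit (R := k) (c i j) = if i = j then 1 else 0 := by
  have h1 := h.leftAct_eq (counit (R := k)) i
  rw [leftAct_counit] at h1
  have h2 : ∑ j, (counit (R := k) (c i j) - if i = j then 1 else 0) • w j = 0 := by
    simp [sub_smul, ← h1]
  exact sub_eq_zero.1 (Fintype.linearIndependent_iff.1 h.linearIndependent _ h2 j)

theorem comul_coeff (h : IsComatrix (k := k) w c) (i j : Fin n) :
    comul (R := k) (c i j) = ∑ l, c i l ⊗ₜ c l j := by
  rw [← sub_eq_zero]
  refine tensor_eq_zero_of_slices fun φ => ?_
  rw [← Module.forall_dual_apply_eq_zero_iff k]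
  intro ψ
  have h1 := leftAct_leftAct ψ φ (w i)
  rw [h.leftAct_eq, h.leftAct_eq, map_sum] at h1
  simp only [map_smul, h.leftAct_eq, Finset.smul_sum, smul_smul] at h1
  rw [Finset.sum_comm] at h1
  simp only [← Finset.sum_smul] at h1
  rw [← sub_eq_zero, ← Finset.sum_sub_distrib] at h1
  simp only [← sub_smul] at h1
  have h2 := Fintype.linearIndependent_iff.1 h.linearIndependent _ h1 j
  have h3 : TensorProduct.lid k A (φ.rTensor A (comul (R := k) (c i j))) =
    leftAct φ (c i j) := rfl
  rw [map_sub, map_sub, map_sub, h3, apply_leftAct, ← sub_eq_zero.1 h2]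
  simp

theorem mem_span_coeff (h : IsComatrix (k := k) w c) (i : Fin n) :
    w i ∈ Submodule.span k (Set.range fun p : Fin n × Fin n => c p.1 p.2) := by
  have h1 : w i = ∑ j, counit (R := k) (w j) • c i j := by
    conv_lhs => rw [← rightAct_counit (k := k) (w i)]
    simp [rightAct, h.comul_eq]
  rw [h1]
  exact Submodule.sum_mem _ fun j _ => Submodule.smul_mem _ _
    (Submodule.subset_span ⟨(i, j), rfl⟩)

end IsComatrix

end Comatrix

section Unipotent

variable {k}

theorem dualConv_comp_coalgHom {C D : Type u} [AddCommGroup C] [Module k C] [Coalgebra k C]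
    [AddCommGroup D] [Module k D] [Coalgebra k D] (π : C →ₗc[k] D) (φ ψ : Module.Dual k D) :
    dualConv k D φ ψ ∘ₗ π.toLinearMap =
      dualConv k C (φ ∘ₗ π.toLinearMap) (ψ ∘ₗ π.toLinearMap) := by
  simp only [dualConv, TensorProduct.map_comp, LinearMap.comp_assoc, π.map_comp_comul]

theorem dualConvProd_comp_coalgHom {C D : Type u} [AddCommGroup C] [Module k C] [Coalgebra k C]
    [AddCommGroup D] [Module k D] [Coalgebra k D] (π : C →ₗc[k] D) {m : ℕ}
    (f : Fin m → Module.Dual k D) :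
    dualConvProd k D f ∘ₗ π.toLinearMap = dualConvProd k C fun i => f i ∘ₗ π.toLinearMap := by
  induction m with
  | zero => simp [dualConvProd]
  | succ m ih =>
    have hD : dualConvProd k D f = dualConv k D (f 0) (dualConvProd k D fun i => f i.succ) := by
      simp [dualConvProd, List.ofFn_succ]
    have hC : (dualConvProd k C fun i => f i ∘ₗ π.toLinearMap) =
        dualConv k C (f 0 ∘ₗ π.toLinearMap)
          (dualConvProd k C fun i => f i.succ ∘ₗ π.toLinearMap) := by
      simp [dualConvProd, List.ofFn_succ]
    rw [hD, hC, dualConv_comp_coalgHom, ih]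

variable {A B : Type u} [CommRing A] [HopfAlgebra k A] [CommRing B] [HopfAlgebra k B]

theorem IsUnipotentHopf.of_injective (hA : IsUnipotentHopf k A) (i : B →ₐc[k] A)
    (hi : Function.Injective i) : IsUnipotentHopf k B := by
  intro x
  obtain ⟨n, hn⟩ := hA (i x)
  refine ⟨n, ?_⟩
  simp only [conilpotencyFiltration, Submodule.mem_iInf, LinearMap.mem_ker] at hn ⊢
  intro f hf
  obtain ⟨r, hr⟩ := LinearMap.exists_leftInverse_of_injective
    (i : B →ₗc[k] A).toLinearMap (LinearMap.ker_eq_bot.2 hi)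
  have hfr : ∀ j, (f j ∘ₗ r) ∘ₗ (i : B →ₗc[k] A).toLinearMap = f j := fun j => by
    rw [LinearMap.comp_assoc, hr, LinearMap.comp_id]
  have h1 : ∀ j, (f j ∘ₗ r) 1 = 0 := fun j => by
    rw [← map_one i]
    exact (LinearMap.congr_fun (hfr j) 1).trans (hf j)
  have h2 := LinearMap.congr_fun (dualConvProd_comp_coalgHom (i : B →ₗc[k] A) fun j => f j ∘ₗ r) x
  simp only [hfr] at h2
  rw [← h2]
  exact hn _ h1

theorem IsUnipotentHopf.of_surjective (hA : IsUnipotentHopf k A) (π : A →ₐc[k] B)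
    (hπ : Function.Surjective π) : IsUnipotentHopf k B := by
  intro x
  obtain ⟨x, rfl⟩ := hπ x
  obtain ⟨n, hn⟩ := hA x
  refine ⟨n, ?_⟩
  simp only [conilpotencyFiltration, Submodule.mem_iInf, LinearMap.mem_ker] at hn ⊢
  intro f hf
  refine (LinearMap.congr_fun (dualConvProd_comp_coalgHom (π : A →ₗc[k] B) f) x).trans
    (hn _ fun j => ?_)
  exact (congrArg (f j) (map_one π)).trans (hf j)

theorem dualConvProd_const_apply {φ : Module.Dual k A} {x : A} {χ : k}
    (hx : leftAct φ x = χ • x) (m : ℕ) :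
    dualConvProd k A (fun _ : Fin m => φ - counit) x = (χ - 1) ^ m * counit (R := k) x := by
  induction m with
  | zero => simp [dualConvProd]
  | succ m ih =>
    have h : dualConvProd k A (fun _ : Fin (m + 1) => φ - counit) =
        dualConv k A (φ - counit) (dualConvProd k A fun _ : Fin m => φ - counit) := by
      simp [dualConvProd, List.ofFn_succ]
    have hsub : leftAct (φ - counit (R := k)) x = (χ - 1) • x := by
      have : leftAct (φ - counit (R := k)) x = leftAct φ x - leftAct (counit (R := k)) x := by
        simp [leftAct, LinearMap.rTensor_sub]
      rw [this, hx, leftAct_counit, sub_smul, one_smul]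
    rw [h, ← apply_leftAct, hsub, map_smul, ih, smul_eq_mul, pow_succ']
    ring

theorem IsUnipotentHopf.eigenvalue_eq_one (hA : IsUnipotentHopf k A) {φ : Module.Dual k A}
    (hφ : φ 1 = 1) {x : A} {χ : k} (hx : leftAct φ x = χ • x) (hx0 : counit (R := k) x ≠ 0) :
    χ = 1 := by
  obtain ⟨n, hn⟩ := hA x
  simp only [conilpotencyFiltration, Submodule.mem_iInf, LinearMap.mem_ker] at hn
  have h := hn (fun _ => φ - counit) fun _ => by simp [hφ]
  rw [dualConvProd_const_apply hx] at h
  exact sub_eq_zero.1 (pow_eq_zero_iff n.succ_ne_zero |>.1 ((mul_eq_zero.1 h).resolve_right hx0))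

theorem IsUnipotentHopf.eq_one_of_comul_eq (hA : IsUnipotentHopf k A) {d : A}
    (hd : comul (R := k) d = d ⊗ₜ d) (hε : counit (R := k) d = 1) : d = 1 := by
  by_contra hne
  obtain ⟨f, hf⟩ : ∃ f : Module.Dual k A, f (d - 1) ≠ 0 := by
    by_contra! hall
    exact hne (sub_eq_zero.1 ((Module.forall_dual_apply_eq_zero_iff k _).1 hall))
  let φ : Module.Dual k A := f + (1 - f 1) • counit
  have hφ1 : φ 1 = 1 := by simp [φ]
  have := hA.eigenvalue_eq_one hφ1 (x := d) (χ := φ d) (by simp [leftAct, hd]) (by simp [hε])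
  apply hf
  simp only [φ, LinearMap.add_apply, LinearMap.smul_apply, hε, smul_eq_mul, mul_one] at this
  rw [map_sub]
  linear_combination this

end Unipotent

section SubHopf

variable {k} {A : Type u} [CommRing A] [HopfAlgebra k A]

/-- A subalgebra of a Hopf algebra that is stable under comultiplication and antipode. -/
structure IsSubHopf (S : Subalgebra k A) : Prop where
  comul_mem : ∀ s ∈ S, comul (R := k) s ∈ (Algebra.TensorProduct.map S.val S.val).range
  antipode_mem : ∀ s ∈ S, antipode k s ∈ S

variable {S : Subalgebra k A}

theorem map_val_injective {M N : Type*} [Ring M] [Algebra k M] [Ring N] [Algebra k N]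
    {M' N' : Type*} [Ring M'] [Algebra k M'] [Ring N'] [Algebra k N']
    {f : M →ₐ[k] M'} {g : N →ₐ[k] N'} (hf : Function.Injective f) (hg : Function.Injective g) :
    Function.Injective (Algebra.TensorProduct.map f g) :=
  TensorProduct.map_injective_of_flat_flat f.toLinearMap g.toLinearMap hf hg

namespace IsSubHopf

/-- The comultiplication of a sub-Hopf algebra. -/
noncomputable def comulHom (h : IsSubHopf S) : S →ₐ[k] S ⊗[k] S :=
  ((AlgEquiv.ofInjective (Algebra.TensorProduct.map S.val S.val)
    (map_val_injective Subtype.val_injective Subtype.val_injective)).symm :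
      (Algebra.TensorProduct.map S.val S.val).range →ₐ[k] S ⊗[k] S).comp
    (((comulAlgHom k A).comp S.val).codRestrict _ fun s => h.comul_mem s s.2)

theorem map_comulHom (h : IsSubHopf S) (s : S) :
    Algebra.TensorProduct.map S.val S.val (h.comulHom s) = comul (R := k) (s : A) :=
  congrArg Subtype.val ((AlgEquiv.ofInjective (Algebra.TensorProduct.map S.val S.val)
    (map_val_injective Subtype.val_injective Subtype.val_injective)).apply_symm_apply _)

theorem map_comp_comulHom (h : IsSubHopf S) :
    (Algebra.TensorProduct.map S.val S.val).comp h.comulHom = (comulAlgHom k A).comp S.val :=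
  AlgHom.ext h.map_comulHom

/-- The bialgebra structure on a sub-Hopf algebra. -/
noncomputable abbrev bialgebra (h : IsSubHopf S) : Bialgebra k S :=
  Bialgebra.ofAlgHom h.comulHom ((counitAlgHom k A).comp S.val)
    (by
      have hinj := map_val_injective (k := k) (f := S.val) Subtype.val_injective
        (map_val_injective (k := k) (f := S.val) (g := S.val)
          Subtype.val_injective Subtype.val_injective)
      refine AlgHom.ext fun s => hinj ?_
      have hL : ∀ t : S ⊗[k] S,
          Algebra.TensorProduct.map S.val (Algebra.TensorProduct.map S.val S.val)
            (Algebra.TensorProduct.assoc k k k S S S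
              (Algebra.TensorProduct.map h.comulHom (.id k S) t)) =
          Algebra.TensorProduct.assoc k k k A A A
            (Algebra.TensorProduct.map (comulAlgHom k A) (.id k A)
              (Algebra.TensorProduct.map S.val S.val t)) := by
        have hassoc : ∀ (r : S ⊗[k] S) (y : S),
            Algebra.TensorProduct.map S.val (Algebra.TensorProduct.map S.val S.val)
              (Algebra.TensorProduct.assoc k k k S S S (r ⊗ₜ y)) =
            Algebra.TensorProduct.assoc k k k A A A
              (Algebra.TensorProduct.map S.val S.val r ⊗ₜ (y : A)) := fun r y => by
          induction r using TensorProduct.induction_on with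
          | zero => simp
          | tmul a b => simp
          | add a b ha hb => simp only [TensorProduct.add_tmul, map_add, ha, hb]
        intro t
        induction t using TensorProduct.induction_on with
        | zero => simp
        | tmul a b => simp [hassoc, h.map_comulHom]
        | add a b ha hb => simp only [map_add, ha, hb]
      have hR : ∀ t : S ⊗[k] S,
          Algebra.TensorProduct.map S.val (Algebra.TensorProduct.map S.val S.val)
            (Algebra.TensorProduct.map (.id k S) h.comulHom t) =
          Algebra.TensorProduct.map (.id k A) (comulAlgHom k A)
              (Algebra.TensorProduct.map S.val S.val t) := by
        intro t
        induction t using TensorProduct.induction_on with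
        | zero => simp
        | tmul a b => simp [h.map_comulHom]
        | add a b ha hb => simp only [map_add, ha, hb]
      refine (hL _).trans (Eq.trans ?_ (hR _).symm)
      erw [h.map_comulHom]
      exact Coalgebra.coassoc_apply (R := k) (s : A))
    (by
      refine AlgHom.ext fun s =>
        map_val_injective (k := k) (f := AlgHom.id k k) (g := S.val) Function.injective_id
          Subtype.val_injective ?_
      refine Eq.trans ?_ ((congrArg (Algebra.TensorProduct.map (counitAlgHom k A) (.id k A))
        (h.map_comulHom s)).trans ?_)
      · change Algebra.TensorProduct.map _ _ (Algebra.TensorProduct.map _ _ (h.comulHom s)) = _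
        generalize h.comulHom s = t
        induction t using TensorProduct.induction_on with
        | zero => simp
        | tmul a b => simp
        | add a b ha hb => simp only [map_add, ha, hb]
      · exact Coalgebra.rTensor_counit_comul (R := k) (s : A))
    (by
      refine AlgHom.ext fun s =>
        map_val_injective (k := k) (f := S.val) (g := AlgHom.id k k)
          Subtype.val_injective Function.injective_id ?_
      refine Eq.trans ?_ ((congrArg (Algebra.TensorProduct.map (.id k A) (counitAlgHom k A))
        (h.map_comulHom s)).trans ?_)
      · change Algebra.TensorProduct.map _ _ (Algebra.TensorProduct.map _ _ (h.comulHom s)) = _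
        generalize h.comulHom s = t
        induction t using TensorProduct.induction_on with
        | zero => simp
        | tmul a b => simp
        | add a b ha hb => simp only [map_add, ha, hb]
      · exact Coalgebra.lTensor_counit_comul (R := k) (s : A))

/-- The Hopf algebra structure on a sub-Hopf algebra. -/
noncomputable abbrev hopfAlgebra (h : IsSubHopf S) : HopfAlgebra k S :=
  letI := h.bialgebra
  HopfAlgebra.ofAlgHom (((antipodeAlgHom k A).comp S.val).codRestrict S
      fun s => h.antipode_mem s s.2)
    (by
      refine AlgHom.ext fun s => Subtype.val_injective ?_
      refine Eq.trans ?_ (mul_antipode_rTensor_comul_apply (R := k) (s : A))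
      rw [← h.map_comulHom s]
      change S.val (Algebra.TensorProduct.lift _ _ (fun _ _ => Commute.all _ _)
        (h.comulHom s)) = _
      generalize h.comulHom s = t
      induction t using TensorProduct.induction_on with
      | zero => simp
      | tmul a b => simp; rfl
      | add a b ha hb => simp only [map_add, ha, hb])
    (by
      refine AlgHom.ext fun s => Subtype.val_injective ?_
      refine Eq.trans ?_ (mul_antipode_lTensor_comul_apply (R := k) (s : A))
      rw [← h.map_comulHom s]
      change S.val (Algebra.TensorProduct.lift _ _ (fun _ _ => Commute.all _ _)
        (h.comulHom s)) = _
      generalize h.comulHom s = t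
      induction t using TensorProduct.induction_on with
      | zero => simp
      | tmul a b => simp; rfl
      | add a b ha hb => simp only [map_add, ha, hb])

/-- The inclusion of a sub-Hopf algebra. -/
noncomputable def incl (h : IsSubHopf S) :
    letI := h.hopfAlgebra
    S →ₐc[k] A :=
  letI := h.hopfAlgebra
  BialgHom.ofAlgHom S.val rfl h.map_comp_comulHom

end IsSubHopf

theorem IsComatrix.isSubHopf (hA : IsUnipotentHopf k A) {n : ℕ} {w : Fin n → A}
    {c : Matrix (Fin n) (Fin n) A} (h : IsComatrix (k := k) w c) :
    IsSubHopf (Algebra.adjoin k (Set.range fun p : Fin n × Fin n => c p.1 p.2)) := by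
  set S := Algebra.adjoin k (Set.range fun p : Fin n × Fin n => c p.1 p.2)
  have hc : ∀ i j, c i j ∈ S := fun i j => Algebra.subset_adjoin ⟨(i, j), rfl⟩
  let incl₁ : A →ₐ[k] A ⊗[k] A := Algebra.TensorProduct.includeLeft
  let incl₂ : A →ₐ[k] A ⊗[k] A := Algebra.TensorProduct.includeRight
  have hdet : c.det = 1 := by
    refine hA.eq_one_of_comul_eq ?_ ?_
    · have hm : (comulAlgHom k A).mapMatrix c = incl₁.mapMatrix c * incl₂.mapMatrix c := by
        ext i j
        simp [Matrix.mul_apply, incl₁, incl₂, h.comul_coeff]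
      have := congrArg Matrix.det hm
      rw [Matrix.det_mul, ← AlgHom.map_det, ← AlgHom.map_det, ← AlgHom.map_det] at this
      simpa [incl₁, incl₂] using this
    · have hm : (counitAlgHom k A).mapMatrix c = 1 := by
        ext i j
        simp [h.counit_eq, Matrix.one_apply]
      have := congrArg Matrix.det hm
      rw [← AlgHom.map_det] at this
      simpa using this
  have hanti : (antipodeAlgHom k A).mapMatrix c = c.adjugate := by
    have hm : (antipodeAlgHom k A).mapMatrix c * c = 1 := by
      ext i j
      have := mul_antipode_rTensor_comul_apply (R := k) (c i j)
      rw [h.comul_coeff, h.counit_eq] at this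
      simp only [map_sum, LinearMap.rTensor_tmul, LinearMap.mul'_apply] at this
      simp only [Matrix.mul_apply, AlgHom.mapMatrix_apply, Matrix.map_apply, Matrix.one_apply]
      refine this.trans ?_
      split_ifs <;> simp
    calc (antipodeAlgHom k A).mapMatrix c
        = (antipodeAlgHom k A).mapMatrix c * (c * c.adjugate) := by
          rw [Matrix.mul_adjugate, hdet, one_smul, mul_one]
      _ = c.adjugate := by rw [← mul_assoc, hm, one_mul]
  have hadj : ∀ i j, c.adjugate i j ∈ S := by
    intro i j
    let c' : Matrix (Fin n) (Fin n) S := fun i j => ⟨c i j, hc i j⟩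
    have : S.val.mapMatrix c' = c := rfl
    rw [← this, ← AlgHom.map_adjugate]
    exact (c'.adjugate i j).2
  refine ⟨?_, ?_⟩
  · suffices S ≤ (Algebra.TensorProduct.map S.val S.val).range.comap (comulAlgHom k A) from
      fun s hs => this hs
    refine Algebra.adjoin_le ?_
    rintro _ ⟨⟨i, j⟩, rfl⟩
    change comul (R := k) (c i j) ∈ (Algebra.TensorProduct.map S.val S.val).range
    rw [h.comul_coeff]
    exact sum_mem fun l _ => ⟨(⟨c i l, hc i l⟩ : S) ⊗ₜ (⟨c l j, hc l j⟩ : S), by simp⟩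
  · suffices S ≤ S.comap (antipodeAlgHom k A) from fun s hs => this hs
    refine Algebra.adjoin_le ?_
    rintro _ ⟨⟨i, j⟩, rfl⟩
    change (antipodeAlgHom k A).mapMatrix c i j ∈ S
    rw [hanti]
    exact hadj i j

theorem IsComatrix.span_le_adjoin {n : ℕ} {w : Fin n → A} {c : Matrix (Fin n) (Fin n) A}
    (h : IsComatrix (k := k) w c) : Submodule.span k (Set.range w) ≤
      (Algebra.adjoin k (Set.range fun p : Fin n × Fin n => c p.1 p.2)).toSubmodule := by
  refine Submodule.span_le.2 ?_
  rintro _ ⟨i, rfl⟩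
  exact Algebra.span_le_adjoin k _ (h.mem_span_coeff i)

theorem IsComatrix.finiteType {n : ℕ} (c : Matrix (Fin n) (Fin n) A) :
    Algebra.FiniteType k (Algebra.adjoin k (Set.range fun p : Fin n × Fin n => c p.1 p.2)) :=
  (Subalgebra.fg_iff_finiteType _).1 (Subalgebra.fg_def.2 ⟨_, Set.finite_range _, rfl⟩)

end SubHopf

section Points

variable {k} {A : Type u} [CommRing A] [HopfAlgebra k A] {Γ : Type u} {η : Γ → (A →ₐ[k] k)}

theorem convPoint_apply (φ ψ : A →ₐ[k] k) (x : A) :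
    convPoint k φ ψ x = dualConv k A φ.toLinearMap ψ.toLinearMap x := by
  rw [dualConv_eq_convMul]
  rfl

/-- The ideal of functions vanishing on a family of points. -/
def vanishingIdeal (η : Γ → (A →ₐ[k] k)) : Ideal A :=
  ⨅ γ, RingHom.ker (η γ)

theorem mem_vanishingIdeal {x : A} : x ∈ vanishingIdeal η ↔ ∀ γ, η γ x = 0 := by
  simp [vanishingIdeal, Submodule.mem_iInf, RingHom.mem_ker]

variable [Group Γ]

/-- The homomorphism into the convolution group of points attached to a multiplicative map. -/
noncomputable def pointsHom (hη : ∀ γ₁ γ₂ : Γ, η (γ₁ * γ₂) = convPoint k (η γ₁) (η γ₂)) :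
    Γ →* WithConv (A →ₐ[k] k) :=
  MonoidHom.mk' (fun γ => WithConv.toConv (η γ)) fun γ₁ γ₂ => by rw [hη]; rfl

theorem point_one (hη : ∀ γ₁ γ₂ : Γ, η (γ₁ * γ₂) = convPoint k (η γ₁) (η γ₂)) (x : A) :
    η 1 x = counit (R := k) x :=
  congrArg (fun φ : WithConv (A →ₐ[k] k) => φ.ofConv x) (map_one (pointsHom hη))

theorem point_antipode (hη : ∀ γ₁ γ₂ : Γ, η (γ₁ * γ₂) = convPoint k (η γ₁) (η γ₂)) (γ : Γ)
    (x : A) : η γ (antipode k x) = η γ⁻¹ x :=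
  (congrArg (fun φ : WithConv (A →ₐ[k] k) => φ.ofConv x) (map_inv (pointsHom hη) γ)).symm

theorem point_leftAct (hη : ∀ γ₁ γ₂ : Γ, η (γ₁ * γ₂) = convPoint k (η γ₁) (η γ₂)) (γ δ : Γ)
    (x : A) : η δ (leftAct (η γ).toLinearMap x) = η (γ * δ) x := by
  rw [hη, convPoint_apply, ← apply_leftAct]
  rfl

theorem point_rightAct (hη : ∀ γ₁ γ₂ : Γ, η (γ₁ * γ₂) = convPoint k (η γ₁) (η γ₂)) (γ δ : Γ)
    (x : A) : η γ (rightAct (η δ).toLinearMap x) = η (γ * δ) x := by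
  rw [hη, convPoint_apply, ← apply_rightAct]
  rfl

theorem convPoint_comp {B : Type u} [CommRing B] [HopfAlgebra k B] (φ ψ : A →ₐ[k] k)
    (i : B →ₐc[k] A) : convPoint k (φ.comp (i : B →ₐ[k] A)) (ψ.comp (i : B →ₐ[k] A)) =
      (convPoint k φ ψ).comp (i : B →ₐ[k] A) := by
  refine AlgHom.ext fun x => ?_
  rw [AlgHom.comp_apply, convPoint_apply, convPoint_apply]
  exact (LinearMap.congr_fun
    (dualConv_comp_coalgHom (i : B →ₗc[k] A) φ.toLinearMap ψ.toLinearMap) x).symm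

theorem isHopfIdeal_vanishingIdeal
    (hη : ∀ γ₁ γ₂ : Γ, η (γ₁ * γ₂) = convPoint k (η γ₁) (η γ₂)) :
    (vanishingIdeal η).IsHopfIdeal k where
  counit_eq_zero x hx := by
    rw [← point_one hη]
    exact mem_vanishingIdeal.1 hx 1
  map_mkQ_comul_eq_zero x hx := by
    set I := (vanishingIdeal η).restrictScalars k
    let η' (γ : Γ) : Module.Dual k (A ⧸ I) :=
      I.liftQ (η γ).toLinearMap fun y hy => mem_vanishingIdeal.1 hy γ
    have hsep : ∀ m, (∀ φ ∈ Set.range η', φ m = 0) → m = 0 := by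
      intro m hm
      obtain ⟨m, rfl⟩ := I.mkQ_surjective m
      exact (Submodule.Quotient.mk_eq_zero I).2
        (mem_vanishingIdeal.2 fun γ => hm _ ⟨γ, rfl⟩)
    refine tensor_eq_zero_of_separating hsep ?_
    rintro _ ⟨γ, rfl⟩
    refine hsep _ ?_
    rintro _ ⟨δ, rfl⟩
    have : ∀ t : A ⊗[k] A, η' δ (TensorProduct.lid k (A ⧸ I) ((η' γ).rTensor (A ⧸ I)
        (TensorProduct.map I.mkQ I.mkQ t))) = η δ (TensorProduct.lid k A
          ((η γ).toLinearMap.rTensor A t)) := fun t => by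
      induction t using TensorProduct.induction_on with
      | zero => simp
      | tmul a b => simp [η']; rfl
      | add a b ha hb => simp only [map_add, ha, hb]
    rw [this]
    exact (point_leftAct hη γ δ x).trans (mem_vanishingIdeal.1 hx _)
  antipode_mem x hx := mem_vanishingIdeal.2 fun γ => by
    rw [point_antipode hη]
    exact mem_vanishingIdeal.1 hx _

theorem IsProunipotentCompletion.eq_zero_of_points (h : IsProunipotentCompletion k Γ A η) {x : A}
    (hx : ∀ γ, η γ x = 0) : x = 0 := by
  obtain ⟨hA, hη, huniv⟩ := h
  obtain ⟨n, w, c, hwc, hxw, -⟩ := exists_isComatrix (k := k) x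
  have hS := hwc.isSubHopf hA
  have hft := IsComatrix.finiteType (k := k) c
  have hxS : x ∈ Algebra.adjoin k (Set.range fun p : Fin n × Fin n => c p.1 p.2) :=
    hwc.span_le_adjoin hxw
  generalize Algebra.adjoin k (Set.range fun p : Fin n × Fin n => c p.1 p.2) = S at hS hft hxS
  let := hS.hopfAlgebra
  have hinj : Function.Injective hS.incl := Subtype.val_injective
  have hSu : IsUnipotentHopf k S := hA.of_injective hS.incl hinj
  let θ : Γ → (S →ₐ[k] k) := fun γ => (η γ).comp (hS.incl : S →ₐ[k] A)
  have hθ : ∀ γ₁ γ₂ : Γ, θ (γ₁ * γ₂) = convPoint k (θ γ₁) (θ γ₂) := fun γ₁ γ₂ => by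
    rw [convPoint_comp, ← hη]
  have := isHopfIdeal_vanishingIdeal hθ
  let T := S ⧸ vanishingIdeal θ
  let π : S →ₐc[k] T := Bialgebra.Quotient.mkBialgHom (vanishingIdeal θ)
  have hπ : Function.Surjective π := Ideal.Quotient.mk_surjective
  let ρ : Γ → (T →ₐ[k] k) := fun γ =>
    Ideal.Quotient.liftₐ (vanishingIdeal θ) (θ γ) fun y hy => mem_vanishingIdeal.1 hy γ
  have hρπ : ∀ γ, (ρ γ).comp (π : S →ₐ[k] T) = θ γ := fun γ => AlgHom.ext fun s => rfl
  have hρ : ∀ γ₁ γ₂ : Γ, ρ (γ₁ * γ₂) = convPoint k (ρ γ₁) (ρ γ₂) := fun γ₁ γ₂ => by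
    have h1 : (ρ (γ₁ * γ₂)).comp (π : S →ₐ[k] T) =
        (convPoint k (ρ γ₁) (ρ γ₂)).comp (π : S →ₐ[k] T) := by
      rw [← convPoint_comp, hρπ, hρπ, hρπ, hθ]
    refine AlgHom.ext fun t => ?_
    obtain ⟨s, rfl⟩ := hπ t
    exact DFunLike.congr_fun h1 s
  have hTft : Algebra.FiniteType k T := Algebra.FiniteType.of_surjective (π : S →ₐ[k] T) hπ
  obtain ⟨F, hF, -⟩ := huniv T _ _ (hSu.of_surjective π hπ) hTft ρ hρ
  obtain ⟨G, -, hG⟩ := huniv S _ _ hSu hft θ hθ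
  have h1 := hG hS.incl fun γ => rfl
  have h2 := hG (F.comp π) fun γ => by
    rw [← hρπ, ← hF]
    rfl
  have h3 : (hS.incl : S →ₐc[k] A) ⟨x, hxS⟩ = F (π ⟨x, hxS⟩) := by rw [h1, ← h2]; rfl
  have h4 : π ⟨x, hxS⟩ = 0 := Ideal.Quotient.eq_zero_iff_mem.2 (mem_vanishingIdeal.2 hx)
  rw [h4, map_zero] at h3
  exact h3

end Points

section Invariants

variable {k} {A : Type u} [CommRing A] [HopfAlgebra k A] {Γ : Type u} [Group Γ]
  {η : Γ → (A →ₐ[k] k)}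

theorem IsProunipotentCompletion.eq_of_points (h : IsProunipotentCompletion k Γ A η) {x y : A}
    (hxy : ∀ γ, η γ x = η γ y) : x = y :=
  sub_eq_zero.1 (h.eq_zero_of_points fun γ => by rw [map_sub, hxy, sub_self])

/-- The coefficients of a comodule of left invariant functions are left invariant. -/
theorem IsComatrix.coeff_invariant (h : IsProunipotentCompletion k Γ A η) {n : ℕ} {w : Fin n → A}
    {c : Matrix (Fin n) (Fin n) A} (hwc : IsComatrix (k := k) w c) {m : Γ}
    (hw : ∀ i γ, η (m * γ) (w i) = η γ (w i)) (γ : Γ) (i j : Fin n) :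
    η (m * γ) (c i j) = η γ (c i j) := by
  have h1 : ∑ j, (η (m * γ) (c i j) - η γ (c i j)) • w j = 0 := by
    simp_rw [sub_smul, Finset.sum_sub_distrib]
    rw [sub_eq_zero]
    refine (hwc.leftAct_eq (η (m * γ)).toLinearMap i).symm.trans
      (Eq.trans ?_ (hwc.leftAct_eq (η γ).toLinearMap i))
    refine h.eq_of_points fun δ => ?_
    rw [point_leftAct h.2.1, point_leftAct h.2.1, mul_assoc, hw]
  exact sub_eq_zero.1 (Fintype.linearIndependent_iff.1 hwc.linearIndependent _ h1 j)

/-- Functions invariant under left translation by a normal subgroup `N` stay so under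
the operators `leftAct φ`. -/
theorem leftAct_invariant (h : IsProunipotentCompletion k Γ A η) {N : Subgroup Γ} [hN : N.Normal]
    {x : A} (hx : ∀ n ∈ N, ∀ γ, η (n * γ) x = η γ x) (φ : Module.Dual k A) {n : Γ} (hn : n ∈ N)
    (γ : Γ) : η (n * γ) (leftAct φ x) = η γ (leftAct φ x) := by
  have key : ∀ δ, η δ (leftAct φ x) = φ (rightAct (η δ).toLinearMap x) := fun δ =>
    (apply_leftAct (η δ).toLinearMap φ x).trans (apply_rightAct φ (η δ).toLinearMap x).symm
  rw [key, key]
  congr 1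
  refine h.eq_of_points fun α => ?_
  rw [point_rightAct h.2.1, point_rightAct h.2.1,
    show α * (n * γ) = α * n * α⁻¹ * (α * γ) by group]
  exact hx _ (hN.conj_mem n hn α) _

/-- A function on the completion of `Γ` which is invariant under the kernel of a surjection
`Γ → Γ'` comes from the completion of `Γ'`. -/
theorem IsProunipotentCompletion.exists_of_invariant (h : IsProunipotentCompletion k Γ A η)
    {Γ' A' : Type u} [Group Γ'] [CommRing A'] [HopfAlgebra k A'] {η' : Γ' → (A' →ₐ[k] k)}
    (h' : IsProunipotentCompletion k Γ' A' η') {g : Γ →* Γ'} (hg : Function.Surjective g)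
    {u : A' →ₐc[k] A} (hu : ∀ γ, (η γ).comp (u : A' →ₐ[k] A) = η' (g γ)) {x : A}
    (hx : ∀ n ∈ g.ker, ∀ γ, η (n * γ) x = η γ x) : ∃ y, u y = x := by
  obtain ⟨n, w, c, hwc, hxw, hw⟩ := exists_isComatrix (k := k) x
  have hc : ∀ m ∈ g.ker, ∀ γ i j, η (m * γ) (c i j) = η γ (c i j) := fun m hm γ i j =>
    hwc.coeff_invariant h (fun i γ => by
      obtain ⟨φ, hφ⟩ := hw i
      rw [← hφ]
      exact leftAct_invariant h hx φ hm γ) γ i j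
  have hS := hwc.isSubHopf h.1
  have hft := IsComatrix.finiteType (k := k) c
  have hxS : x ∈ Algebra.adjoin k (Set.range fun p : Fin n × Fin n => c p.1 p.2) :=
    hwc.span_le_adjoin hxw
  have hSinv : ∀ m ∈ g.ker, ∀ γ,
      ∀ s ∈ Algebra.adjoin k (Set.range fun p : Fin n × Fin n => c p.1 p.2),
      η (m * γ) s = η γ s := fun m hm γ s hs =>
    (AlgHom.adjoin_le_equalizer _ _ (by rintro _ ⟨p, rfl⟩; exact hc m hm γ _ _) :
      _ ≤ AlgHom.equalizer (η (m * γ)) (η γ)) hs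
  generalize Algebra.adjoin k (Set.range fun p : Fin n × Fin n => c p.1 p.2) = S
    at hS hft hxS hSinv
  let := hS.hopfAlgebra
  have hSu : IsUnipotentHopf k S := h.1.of_injective hS.incl Subtype.val_injective
  let ρ : Γ' → (S →ₐ[k] k) := fun γ =>
    (η (Function.surjInv hg γ)).comp (hS.incl : S →ₐ[k] A)
  have hρg : ∀ γ, ρ (g γ) = (η γ).comp (hS.incl : S →ₐ[k] A) := fun γ => AlgHom.ext fun s => by
    have hm : Function.surjInv hg (g γ) * γ⁻¹ ∈ g.ker := by
      rw [MonoidHom.mem_ker, map_mul, Function.surjInv_eq hg, map_inv, mul_inv_cancel]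
    have := hSinv _ hm γ s s.2
    rwa [inv_mul_cancel_right] at this
  have hρ : ∀ γ₁ γ₂, ρ (γ₁ * γ₂) = convPoint k (ρ γ₁) (ρ γ₂) := fun γ₁ γ₂ => by
    obtain ⟨γ₁, rfl⟩ := hg γ₁
    obtain ⟨γ₂, rfl⟩ := hg γ₂
    rw [← map_mul, hρg, hρg, hρg, convPoint_comp, ← h.2.1]
  obtain ⟨F, hF, -⟩ := h'.2.2 S _ _ hSu hft ρ hρ
  refine ⟨F ⟨x, hxS⟩, h.eq_of_points fun γ => ?_⟩
  exact (DFunLike.congr_fun (hu γ) _).trans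
    ((DFunLike.congr_fun (hF (g γ)) _).trans (DFunLike.congr_fun (hρg γ) _))

end Invariants

/-- Finitely many independent functions have a nonsingular matrix of values at suitable points. -/
theorem exists_det_ne_zero {K X : Type*} [Field K] {d : ℕ} {w : Fin d → X → K}
    (hw : LinearIndependent K w) :
    ∃ h : Fin d → X, (Matrix.of fun i j => w i (h j)).det ≠ 0 := by
  have htop : Submodule.span K (Set.range fun x i => w i x) = ⊤ := by
    by_contra hne
    obtain ⟨φ, hφ0, hφ⟩ := Submodule.exists_le_ker_of_lt_top _ (lt_top_iff_ne_top.2 hne)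
    refine hφ0 (LinearMap.pi_ext' fun i => LinearMap.ext_ring ?_)
    refine Fintype.linearIndependent_iff.1 hw (fun i => φ (Pi.single i 1)) (funext fun x => ?_) i
    have hx : φ (fun i => w i x) = 0 := hφ (Submodule.subset_span ⟨x, rfl⟩)
    rw [LinearMap.pi_apply_eq_sum_univ] at hx
    have hsingle : ∀ i : Fin d, (fun j => if i = j then (1 : K) else 0) = Pi.single i 1 :=
      fun i => funext fun j => by simp [Pi.single_apply, eq_comm]
    simp_rw [hsingle] at hx
    simpa [mul_comm] using hx
  obtain ⟨v, hv, -, hvi⟩ := Submodule.exists_fun_fin_finrank_span_eq K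
    (Set.range fun x i => w i x)
  have hd : Module.finrank K (Submodule.span K (Set.range fun x i => w i x)) = d := by
    rw [htop, finrank_top, Module.finrank_fin_fun]
  choose h hh using hv
  refine ⟨h ∘ finCongr hd.symm, ?_⟩
  have hli : LinearIndependent K (v ∘ finCongr hd.symm) := hvi.comp _ (finCongr hd.symm).injective
  rw [← Matrix.det_transpose, ← isUnit_iff_ne_zero, ← Matrix.isUnit_iff_isUnit_det,
    ← Matrix.linearIndependent_rows_iff_isUnit]
  convert hli using 1
  funext j
  exact hh _

section Determinants

variable {k} {A : Type u} [CommRing A] [HopfAlgebra k A] {Γ : Type u} [Group Γ]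
  {η : Γ → (A →ₐ[k] k)} {d : ℕ} {w : Fin d → A}

variable (η w) in
/-- The matrix of the right translates of the functions `w i` by the points `h j`. -/
noncomputable def translateMatrix (h : Fin d → Γ) : Matrix (Fin d) (Fin d) A :=
  Matrix.of fun i j => rightAct (η (h j)).toLinearMap (w i)

theorem point_det_translateMatrix
    (hη : ∀ γ₁ γ₂ : Γ, η (γ₁ * γ₂) = convPoint k (η γ₁) (η γ₂)) (h : Fin d → Γ) (γ : Γ) :
    η γ (translateMatrix η w h).det = (Matrix.of fun i j => η (γ * h j) (w i)).det := by
  rw [AlgHom.map_det]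
  congr 1
  ext i j
  exact point_rightAct hη _ _ _

theorem updateCol_translateMatrix
    (hη : ∀ γ₁ γ₂ : Γ, η (γ₁ * γ₂) = convPoint k (η γ₁) (η γ₂)) (h : Fin d → Γ) (j : Fin d) :
    (translateMatrix η w h).updateCol j w = translateMatrix η w (Function.update h j 1) := by
  ext i j'
  rw [Matrix.updateCol_apply]
  by_cases hj : j' = j
  · subst hj
    have h1 : (η 1).toLinearMap = counit (R := k) := LinearMap.ext fun x => point_one hη x
    simp [translateMatrix, h1, rightAct_counit]
  · simp [translateMatrix, hj]

/-- Translating by a point that acts on the span of the `w i` rescales the determinants of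
translates by the determinant of the action. -/
theorem point_mul_det_translateMatrix
    (hη : ∀ γ₁ γ₂ : Γ, η (γ₁ * γ₂) = convPoint k (η γ₁) (η γ₂)) {m : Γ}
    {R : Matrix (Fin d) (Fin d) k}
    (hR : ∀ i, leftAct (η m).toLinearMap (w i) = ∑ l, R i l • w l) (h : Fin d → Γ) (γ : Γ) :
    η (m * γ) (translateMatrix η w h).det = R.det * η γ (translateMatrix η w h).det := by
  rw [point_det_translateMatrix hη, point_det_translateMatrix hη, ← Matrix.det_mul]
  congr 1
  ext i j
  rw [Matrix.of_apply, mul_assoc, ← point_leftAct hη, hR]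
  simp [Matrix.mul_apply]

/-- A function vanishing on a normal subgroup `N` lies in every ideal containing the
`N`-invariant functions of counit zero. -/
theorem IsProunipotentCompletion.mem_of_vanishing (hA : IsProunipotentCompletion k Γ A η)
    {N : Subgroup Γ} {J : Ideal A}
    (hJ : ∀ x, (∀ n ∈ N, ∀ γ, η (n * γ) x = η γ x) → counit (R := k) x = 0 → x ∈ J)
    {x : A} (hx : ∀ n ∈ N, η n x = 0) : x ∈ J := by
  have hη := hA.2.1
  let W := Submodule.span k (Set.range fun n : N => leftAct (η n).toLinearMap x)
  have hWstab : ∀ m ∈ N, ∀ y ∈ W, leftAct (η m).toLinearMap y ∈ W := fun m hm y hy => by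
    refine (Submodule.span_le.2 ?_ : W ≤ W.comap (leftAct (η m).toLinearMap)) hy
    rintro _ ⟨n, rfl⟩
    refine Submodule.subset_span ⟨n * ⟨m, hm⟩, hA.eq_of_points fun δ => ?_⟩
    rw [point_leftAct hη, point_leftAct hη, point_leftAct hη, Subgroup.coe_mul, mul_assoc]
  have hWvan : ∀ y ∈ W, η 1 y = 0 := fun y hy => by
    refine (Submodule.span_le.2 ?_ : W ≤ LinearMap.ker (η 1).toLinearMap) hy
    rintro _ ⟨n, rfl⟩
    exact (point_leftAct hη _ _ _).trans (by rw [mul_one]; exact hx n n.2)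
  have hxW : x ∈ W := Submodule.subset_span ⟨1, hA.eq_of_points fun δ => by
    rw [point_leftAct hη, Subgroup.coe_one, one_mul]⟩
  have hfin : FiniteDimensional k W := by
    obtain ⟨s, hs⟩ := finiteDimensional_range_leftAct (k := k) x
    exact Submodule.finiteDimensional_of_le
      (Submodule.span_le.2 (by rintro _ ⟨n, rfl⟩; exact hs _) : W ≤ Submodule.span k (s : Set A))
  let b := Module.finBasis k W
  let w := fun i => (b i : A)
  have hwi : LinearIndependent k fun i γ => η γ (w i) := by
    refine Fintype.linearIndependent_iff.2 fun c hc => ?_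
    refine Fintype.linearIndependent_iff.1 b.linearIndependent c (Subtype.ext ?_)
    refine hA.eq_zero_of_points fun γ => ?_
    simpa [w] using congrFun hc γ
  obtain ⟨h, hh⟩ := exists_det_ne_zero hwi
  have hcounit : ∀ h, counit (R := k) (translateMatrix η w h).det =
      (Matrix.of fun i j => η (h j) (w i)).det := fun h => by
    simp [← point_one hη, point_det_translateMatrix hη]
  have hinv : ∀ h, ∀ n ∈ N, ∀ γ, η (n * γ) (translateMatrix η w h).det =
      η γ (translateMatrix η w h).det := fun h' n hn γ => by
    let R : Matrix _ _ k := Matrix.of fun i l => b.repr ⟨_, hWstab n hn _ (b i).2⟩ l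
    have hR : ∀ i, leftAct (η n).toLinearMap (w i) = ∑ l, R i l • w l := fun i => by
      have := congrArg Subtype.val (b.sum_repr ⟨_, hWstab n hn _ (b i).2⟩)
      rw [AddSubmonoidClass.coe_finsetSum] at this
      exact this.symm
    have hdet : R.det = 1 := by
      refine hA.1.eigenvalue_eq_one (φ := (η n).toLinearMap) (map_one (η n))
        (x := (translateMatrix η w h).det) (hA.eq_of_points fun δ => ?_)
        ((hcounit h).trans_ne hh)
      rw [point_leftAct hη, point_mul_det_translateMatrix hη hR, map_smul, smul_eq_mul]
    rw [point_mul_det_translateMatrix hη hR, hdet, one_mul]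
  set a := translateMatrix η w h
  set δ := (Matrix.of fun i j => η (h j) (w i)).det
  have hdetJ : a.det - algebraMap k A δ ∈ J := by
    refine hJ _ (fun n hn γ => ?_) ?_
    · rw [map_sub, map_sub, hinv h n hn γ, AlgHom.commutes, AlgHom.commutes]
    · rw [map_sub, hcounit, Bialgebra.counit_algebraMap, sub_self]
  have hcramer : ∀ j, a.cramer w j ∈ J := fun j => by
    rw [Matrix.cramer_apply, updateCol_translateMatrix hη]
    refine hJ _ (hinv _) ?_
    rw [hcounit]
    refine Matrix.det_eq_zero_of_column_eq_zero j fun i => ?_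
    simpa using hWvan _ (b i).2
  have hwJ : ∀ i, w i ∈ J := fun i => by
    have h1 : a.det * w i ∈ J := by
      have h2 := congrFun (a.mulVec_cramer w) i
      rw [Pi.smul_apply, smul_eq_mul] at h2
      rw [← h2, Matrix.mulVec, dotProduct]
      exact J.sum_mem fun j _ => J.mul_mem_left (a i j) (hcramer j)
    have h3 : algebraMap k A δ * w i ∈ J := by
      have := J.sub_mem h1 (J.mul_mem_right (w i) hdetJ)
      rwa [← sub_mul, sub_sub_cancel] at this
    have h4 := J.mul_mem_left (algebraMap k A δ⁻¹) h3
    rwa [← mul_assoc, ← map_mul, inv_mul_cancel₀ hh, map_one, one_mul] at h4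
  have hxs := congrArg Subtype.val (b.sum_repr ⟨x, hxW⟩)
  rw [AddSubmonoidClass.coe_finsetSum] at hxs
  rw [← show _ = x from hxs]
  refine J.sum_mem fun i _ => ?_
  rw [Submodule.coe_smul, Algebra.smul_def]
  exact J.mul_mem_left _ (hwJ i)

end Determinants

/-- **Right exactness of pro-unipotent completion** (Lemma 3.9 / standard):
let `Γ₁ → Γ₂ → Γ₃ → 1` be an exact sequence of groups, and for each `i` let
`(Aᵢ, ηᵢ)` be the pro-unipotent completion of `Γᵢ` over `k`.  Let
`u : A₃ →ₐc A₂` and `v : A₂ →ₐc A₁` be the Hopf algebra morphisms dual to the induced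
morphisms `Γ₂^{uni} → Γ₃^{uni}` and `Γ₁^{uni} → Γ₂^{uni}` (characterized by
compatibility with `η`).  Then the induced sequence
`Γ₁^{uni} → Γ₂^{uni} → Γ₃^{uni} → 1` of pro-unipotent group schemes is exact:

* `u` is injective, i.e. `Γ₂^{uni} → Γ₃^{uni}` is faithfully flat; and
* the image of `Γ₁^{uni}` equals the kernel of `Γ₂^{uni} → Γ₃^{uni}`; dually, the
  vanishing ideal `ker v` of the (closed) image of `Γ₁^{uni}` in `Γ₂^{uni}` equals the
  ideal of the kernel subgroup, generated by the image under `u` of the augmentation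
  ideal of `A₃`. -/
theorem prounipotent_completion_right_exact
    (Γ₁ Γ₂ Γ₃ : Type u) [Group Γ₁] [Group Γ₂] [Group Γ₃]
    (f : Γ₁ →* Γ₂) (g : Γ₂ →* Γ₃)
    (hexact : MonoidHom.range f = MonoidHom.ker g) (hsurj : Function.Surjective g)
    (A₁ A₂ A₃ : Type u) [CommRing A₁] [HopfAlgebra k A₁] [CommRing A₂]
    [HopfAlgebra k A₂] [CommRing A₃] [HopfAlgebra k A₃]
    (η₁ : Γ₁ → (A₁ →ₐ[k] k)) (η₂ : Γ₂ → (A₂ →ₐ[k] k)) (η₃ : Γ₃ → (A₃ →ₐ[k] k))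
    (h₁ : IsProunipotentCompletion k Γ₁ A₁ η₁)
    (h₂ : IsProunipotentCompletion k Γ₂ A₂ η₂)
    (h₃ : IsProunipotentCompletion k Γ₃ A₃ η₃)
    (u : A₃ →ₐc[k] A₂) (hu : ∀ γ : Γ₂, (η₂ γ).comp (u : A₃ →ₐ[k] A₂) = η₃ (g γ))
    (v : A₂ →ₐc[k] A₁) (hv : ∀ γ : Γ₁, (η₁ γ).comp (v : A₂ →ₐ[k] A₁) = η₂ (f γ)) :
    Function.Injective u ∧
    RingHom.ker (v : A₂ →+* A₁) =
      Ideal.span ((u : A₃ → A₂) '' {x : A₃ | Coalgebra.counit (R := k) x = 0}) := by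
  refine ⟨(injective_iff_map_eq_zero u).2 fun x hx => h₃.eq_zero_of_points fun γ => ?_, ?_⟩
  · obtain ⟨γ, rfl⟩ := hsurj γ
    rw [← hu]
    exact (congrArg (η₂ γ) hx).trans (map_zero _)
  have hker : ∀ x, x ∈ RingHom.ker (v : A₂ →+* A₁) ↔ ∀ n ∈ g.ker, η₂ n x = 0 := fun x => by
    have hηv : ∀ γ, η₁ γ (v x) = η₂ (f γ) x := fun γ => DFunLike.congr_fun (hv γ) x
    rw [← hexact]
    constructor
    · rintro hx _ ⟨γ, rfl⟩
      rw [← hηv]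
      exact (congrArg (η₁ γ) hx).trans (map_zero _)
    · exact fun hx => h₁.eq_zero_of_points fun γ => (hηv γ).trans (hx _ ⟨γ, rfl⟩)
  have hηu : ∀ γ y, η₂ γ (u y) = η₃ (g γ) y := fun γ y => DFunLike.congr_fun (hu γ) y
  refine le_antisymm (fun x hx => ?_) (Ideal.span_le.2 ?_)
  · refine h₂.mem_of_vanishing (N := g.ker) (fun y hy hy0 => ?_) ((hker x).1 hx)
    obtain ⟨z, rfl⟩ := h₂.exists_of_invariant h₃ hsurj hu hy
    refine Ideal.subset_span ⟨z, ?_, rfl⟩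
    rwa [← point_one h₂.2.1, hηu, map_one, point_one h₃.2.1] at hy0
  · rintro _ ⟨y, hy, rfl⟩
    refine (hker _).2 fun n hn => ?_
    rw [hηu, hn, point_one h₃.2.1]
    exact hy
end
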